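/- Fix integers $d,m\ge 1$ and let $M=\{1,\dots,m\}$. For $i,j\in M$ let $b(\cdot,i):\mathbb R^d\to\mathbb R^d$ and $\sigma(\cdot,i):\mathbb R^d\to\mathbb R^{d\times d}$ be continuous, $q_{ij}:\mathbb R^d\to\mathbb R$ bounded and Borel, and $\widetilde\pi_i:\mathbb R^d\times\mathbb R^d\to[0,\infty)$ Borel; put $a=\sigma\sigma^{\top}$ and $\pi_i(x,dz)=\widetilde\pi_i(x,z)\,dz$. Let $B(x,r)$ denote the open ball; a domain is a nonempty connected open set. Assume: (A1) $\sum_{k,l}|\sigma_{kl}(x,i)|+\sum_k|b_k(x,i)|\le c(1+|x|)$ for some $c>0$ and all $x,i$; $q_{ij}\ge 0$ for $i\ne j$, and $\sum_{j\in M}q_{ij}(x)=0$ for all $x,i$. (A2) For every bounded domain $E$ there is $\kappa_0\in(0,1]$ with $\kappa_0|\xi|^2\le\xi^{\top}a(x,i)\xi\le\kappa_0^{-1}|\xi|^2$ for all $\xi\in\mathbb R^d$, $x\in E$, $i\in M$. (A3) $\int(1\wedge|z|^2)\,\pi_i(x,dz)<\infty$ for all $x,i$; $\sup_{x,i}\pi_i(x,B(0,1)^c)<\infty$;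 $\int_{B(0,1)}|z|^2\,\pi_i(x,dz)\le c(1+|x|^2)$ for some $c>0$ and all $x,i$; and for every $n\ge1$ there is a $\sigma$-finite measure $\Pi_n$ with $\int(1\wedge|z|^2)\,\Pi_n(dz)<\infty$ and $\pi_i(x,\cdot)\le\Pi_n$ for all $x\in B(0,n)$, $i\in M$. (A4) There are $\kappa_2,\beta>0$ such that for every $r\in(0,1)$ there is $\alpha_r$ with $1<\alpha_r<\kappa_2r^{-\beta}$ and $\widetilde\pi_i(x,z-x)\le\alpha_r\,\widetilde\pi_i(y,z-y)$ for all $x_0\in\mathbb R^d$, $x,y\in B(x_0,r/2)$, $z\in B(x_0,r)^c$, $i\in M$. For $f:\mathbb R^d\times M\to\mathbb R$ with $f(\cdot,i)\in C^2(\mathbb R^d)$ for each $i$, put $$\mathcal Gf(x,i)=\tfrac12\sum_{k,l}a_{kl}(x,i)\frac{\partial^2f(x,i)}{\partial x_k\partial x_l}+\sum_kb_k(x,i)\frac{\partial f(x,i)}{\partial x_k}+\int_{\mathbb R^d}\big[f(x+z,i)-f(x,i)-\nabla f(x,i)\cdot z\,\mathbf 1_{\{|z|<1\}}\big]\pi_i(x,dz)+\sum_{j\in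 M}q_{ij}(x)f(x,j)$$ whenever the integral converges absolutely. Let $(X(t),\Lambda(t))_{t\ge0}$ be a càdlàg process with values in $\mathbb R^d\times M$, adapted to a filtration $(\mathcal F_t)$, and let $(\mathbb P_{x,i})_{(x,i)\in\mathbb R^d\times M}$ be probability measures solving the martingale problem for $\mathcal G$: $\mathbb P_{x,i}(X(0)=x,\Lambda(0)=i)=1$ and, for every $f$ with $f(\cdot,j)\in C^2_b(\mathbb R^d)$ for each $j$ (bounded with bounded first and second derivatives) and with $\mathcal Gf$ bounded, the process $f(X(t),\Lambda(t))-f(x,i)-\int_0^t\mathcal Gf(X(s),\Lambda(s))\,ds$ is an $(\mathcal F_t)$-martingale under $\mathbb P_{x,i}$. Suppose that $\mathcal G$ is strictly irreducible on every bounded domain: for every bounded domain $E\subset\mathbb R^d$ and all $i\ne j$ in $M$ there is $q^0_{ij}>0$ with $\inf_{x\in E}q_{ij}(x)\ge q^0_{ij}$. Let $D\subset\mathbb R^d$ be a bounded domain and suppose that condition (C1) holds with respect to $D\times M$: there is $V:\mathbb R^d\times M\to[0,\infty)$ with $V(\cdot,i)\in C^2(\mathbb R^d)$ for each $i$ such that,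 for all $(x,i)\in D^c\times M$, the integral in $\mathcal GV(x,i)$ converges absolutely and $\mathcal GV(x,i)\le-1$. Then for every $(x,i)\in\mathbb R^d\times M$ and every $l\in M$, $$\mathbb E_{x,i}\big[\sigma_{D\times\{l\}}\big]<\infty,\qquad \sigma_{D\times\{l\}}=\inf\{t\ge0:\ X(t)\in D,\ \Lambda(t)=l\}\quad(\inf\emptyset=\infty).$$ -/

import Mathlib

open MeasureTheory Set Filter
open scoped NNReal ENNReal Topology Matrix

noncomputable section

/-- Euclidean state space `ℝ^d`. -/
abbrev Rd (d : ℕ) : Type := EuclideanSpace ℝ (Fin d)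

/-- A bounded domain of `ℝ^d`: a nonempty connected bounded open set. -/
def BddDomain {d : ℕ} (D : Set (Rd d)) : Prop :=
  IsOpen D ∧ IsConnected D ∧ Bornology.IsBounded D

/-- The coefficients of a regime-switching jump diffusion on `ℝ^d × {1,…,m}`. -/
structure Coeffs (d m : ℕ) where
  /-- drift `b(x,i)` -/
  b : Rd d → Fin m → Rd d
  /-- diffusion matrix `σ(x,i)` -/
  sig : Rd d → Fin m → Matrix (Fin d) (Fin d) ℝ
  /-- switching rates `q_{ij}(x)` -/
  q : Rd d → Fin m → Fin m → ℝ
  /-- jump density `π̃_i(x,z)` -/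
  pit : Rd d → Fin m → Rd d → ℝ

namespace Coeffs

variable {d m : ℕ}

/-- `a(x,i) = σ(x,i) σ(x,i)ᵀ` -/
def a (c : Coeffs d m) (x : Rd d) (i : Fin m) : Matrix (Fin d) (Fin d) ℝ :=
  c.sig x i * (c.sig x i)ᵀ

/-- the jump measure `π_i(x,dz) = π̃_i(x,z) dz` -/
def jump (c : Coeffs d m) (x : Rd d) (i : Fin m) : Measure (Rd d) :=
  volume.withDensity fun z => ENNReal.ofReal (c.pit x i z)

/-- The integrand `f(x+z,i) − f(x,i) − ∇f(x,i)·z 1_{|z|<1}` of the nonlocal part of `G`. -/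
def jumpIntegrand (f : Rd d → Fin m → ℝ) (x : Rd d) (i : Fin m) (z : Rd d) : ℝ :=
  f (x + z) i - f x i - (if ‖z‖ < 1 then fderiv ℝ (fun y => f y i) x z else 0)

/-- The generator
`Gf(x,i) = ½ Σ a_{kl} ∂²f/∂x_k∂x_l + Σ b_k ∂f/∂x_k
  + ∫ [f(x+z,i) − f(x,i) − ∇f(x,i)·z 1_{|z|<1}] π_i(x,dz) + Σ_j q_{ij}(x) f(x,j)`.
It is meaningful for `f(·,i)` of class `C²` when `jumpIntegrand f x i` is `π_i(x,·)`-integrable;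
this is automatic for `f(·,i) ∈ C_b²`, and is required explicitly in `IsLyapC1`. -/
def G (c : Coeffs d m) (f : Rd d → Fin m → ℝ) (x : Rd d) (i : Fin m) : ℝ :=
  (1 / 2) * ∑ k, ∑ l, c.a x i k l *
      iteratedFDeriv ℝ 2 (fun y => f y i) x
        ![EuclideanSpace.single k (1 : ℝ), EuclideanSpace.single l (1 : ℝ)]
    + ∑ k, c.b x i k * fderiv ℝ (fun y => f y i) x (EuclideanSpace.single k (1 : ℝ))
    + ∫ z, jumpIntegrand f x i z ∂(c.jump x i)
    + ∑ j, c.q x i j * f x j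

/-- The standing assumptions on the coefficients. -/
structure Standing (c : Coeffs d m) : Prop where
  sig_cont : ∀ i, Continuous fun x => c.sig x i
  b_cont : ∀ i, Continuous fun x => c.b x i
  growth : ∃ C > (0 : ℝ), ∀ x i,
    (∑ k, ∑ l, |c.sig x i k l|) + ∑ k, |c.b x i k| ≤ C * (1 + ‖x‖)
  q_meas : ∀ i j, Measurable fun x => c.q x i j
  q_bdd : ∀ i j, ∃ C : ℝ, ∀ x, |c.q x i j| ≤ C
  q_nonneg : ∀ x i j, i ≠ j → 0 ≤ c.q x i j
  q_rowsum : ∀ x i, ∑ j, c.q x i j = 0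
  /-- local uniform ellipticity of `a` -/
  ellipticity : ∀ D : Set (Rd d), BddDomain D →
    ∃ κ₀ ∈ Set.Ioc (0 : ℝ) 1, ∀ x ∈ D, ∀ (i : Fin m) (ξ : Rd d),
      κ₀ * ‖ξ‖ ^ 2 ≤ ∑ k, ∑ l, ξ k * c.a x i k l * ξ l ∧
      ∑ k, ∑ l, ξ k * c.a x i k l * ξ l ≤ κ₀⁻¹ * ‖ξ‖ ^ 2
  pit_nonneg : ∀ x i z, 0 ≤ c.pit x i z
  pit_meas : ∀ i, Measurable fun p : Rd d × Rd d => c.pit p.1 i p.2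
  levy_integrable : ∀ x i,
    (∫⁻ z, ENNReal.ofReal (min 1 (‖z‖ ^ 2)) ∂(c.jump x i)) < ⊤
  bigjump_bdd : ∃ C : ℝ≥0∞, C < ⊤ ∧ ∀ x i, c.jump x i (Metric.ball (0 : Rd d) 1)ᶜ ≤ C
  smalljump : ∃ C > (0 : ℝ), ∀ x i,
    (∫⁻ z in Metric.ball (0 : Rd d) 1, ENNReal.ofReal (‖z‖ ^ 2) ∂(c.jump x i))
      ≤ ENNReal.ofReal (C * (1 + ‖x‖ ^ 2))
  domination : ∀ n : ℕ, 1 ≤ n → ∃ Pin : Measure (Rd d), SigmaFinite Pin ∧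
    (∫⁻ z, ENNReal.ofReal (min 1 (‖z‖ ^ 2)) ∂Pin) < ⊤ ∧
    ∀ x ∈ Metric.ball (0 : Rd d) n, ∀ i, c.jump x i ≤ Pin
  comparability : ∃ κ₂ > (0 : ℝ), ∃ β > (0 : ℝ), ∀ r ∈ Set.Ioo (0 : ℝ) 1, ∃ αr : ℝ,
    1 < αr ∧ αr < κ₂ * r ^ (-β) ∧
    ∀ (x₀ x y z : Rd d) (i : Fin m),
      x ∈ Metric.ball x₀ (r / 2) → y ∈ Metric.ball x₀ (r / 2) →
      z ∉ Metric.ball x₀ r → c.pit x i (z - x) ≤ αr * c.pit y i (z - y)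

/-- `V` is a Lyapunov function as in condition (C1) with respect to `D × M`: `V ≥ 0` is of
class `C²` in `x` and `GV ≤ −1` on `Dᶜ × M`. The inequality includes that the jump integral of
the (possibly unbounded) function `V` converges at the points of `Dᶜ × M`. -/
def IsLyapC1 (c : Coeffs d m) (D : Set (Rd d)) (V : Rd d → Fin m → ℝ) : Prop :=
  (∀ i, ContDiff ℝ 2 fun y => V y i) ∧ (∀ x i, 0 ≤ V x i) ∧
    ∀ x ∉ D, ∀ i, Integrable (jumpIntegrand V x i) (c.jump x i) ∧ c.G V x i ≤ -1

/-- condition (C1) with respect to `D × M` -/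
def C1 (c : Coeffs d m) (D : Set (Rd d)) : Prop :=
  ∃ V, c.IsLyapC1 D V

/-- `G` is strictly irreducible on `D`. -/
def StrictIrred (c : Coeffs d m) (D : Set (Rd d)) : Prop :=
  ∀ i j : Fin m, i ≠ j → ∃ q0 > (0 : ℝ), ∀ x ∈ D, q0 ≤ c.q x i j

end Coeffs

/-- `f(·,i) ∈ C_b²(ℝ^d)` for each `i`: `f(·,i)` and its partial derivatives up to order two are
continuous and bounded. -/
def IsCb2 {d m : ℕ} (f : Rd d → Fin m → ℝ) : Prop :=
  (∀ i, ContDiff ℝ 2 fun y => f y i) ∧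
    ∀ i, ∃ C : ℝ, ∀ x, |f x i| ≤ C ∧ ‖fderiv ℝ (fun y => f y i) x‖ ≤ C ∧
      ‖iteratedFDeriv ℝ 2 (fun y => f y i) x‖ ≤ C

/-- `(X,Λ)` is, under the family of laws `(P_{x,i})`, a conservative càdlàg process on
`ℝ^d × M` that solves the martingale problem for `(G, C_b²(ℝ^d))` started from every `(x,i)`.

Under linear growth of the coefficients `Gf` may grow quadratically for `f ∈ C_b²`, and then
`∫₀ᵗ Gf(X(s),Λ(s)) ds` need not have a finite mean; the martingale property is therefore only
required of those `f ∈ C_b²` for which `Gf` is bounded (all compactly supported `f` are among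
them). This, and the omission of uniqueness and of the Markov property, only enlarges the class
of processes. -/
structure IsSwitchingJumpDiffusion {d m : ℕ} {Ω : Type*} [mΩ : MeasurableSpace Ω]
    (c : Coeffs d m) (ℱ : Filtration ℝ≥0 mΩ) (X : ℝ≥0 → Ω → Rd d) (Λ : ℝ≥0 → Ω → Fin m)
    (P : Rd d → Fin m → Measure Ω) : Prop where
  prob : ∀ x i, IsProbabilityMeasure (P x i)
  adapted : Adapted ℱ fun t ω => (X t ω, Λ t ω)
  cadlag_right : ∀ ω (t : ℝ≥0),
    ContinuousWithinAt (fun s => (X s ω, Λ s ω)) (Set.Ici t) t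
  cadlag_left : ∀ ω (t : ℝ≥0), 0 < t →
    ∃ L : Rd d × Fin m, Tendsto (fun s => (X s ω, Λ s ω)) (𝓝[<] t) (𝓝 L)
  init : ∀ x i, P x i {ω | X 0 ω = x ∧ Λ 0 ω = i} = 1
  martingale_problem : ∀ f : Rd d → Fin m → ℝ, IsCb2 f →
    (∃ C : ℝ, ∀ x i, |c.G f x i| ≤ C) →
    ∀ x i, Martingale
      (fun t ω => f (X t ω) (Λ t ω) - f x i -
        ∫ u in Set.Ioc (0 : ℝ) (t : ℝ), c.G f (X u.toNNReal ω) (Λ u.toNNReal ω))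
      ℱ (P x i)

/-- First hitting time (valued in `[0,∞]`) of a set `U` by the process `Z`:
`σ_U = inf{t ≥ 0 : Z(t) ∈ U}`. -/
def hitTime {Ω α : Type*} (Z : ℝ≥0 → Ω → α) (U : Set α) (ω : Ω) : ℝ≥0∞ :=
  ⨅ (t : ℝ≥0) (_ : Z t ω ∈ U), (t : ℝ≥0∞)

end

noncomputable section

variable {d m : ℕ}

theorem abs_sub_sub_fderiv_le {f : Rd d → ℝ} (hf : ContDiff ℝ 2 f) {x z : Rd d} {s : Set (Rd d)}
    (hs : Convex ℝ s) (hx : x ∈ s) (hz : x + z ∈ s) {C : ℝ}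
    (hC : ∀ y ∈ s, ‖iteratedFDeriv ℝ 2 f y‖ ≤ C) :
    |f (x + z) - f x - fderiv ℝ f x z| ≤ C * ‖z‖ ^ 2 := by
  have hC0 : 0 ≤ C := (norm_nonneg _).trans (hC x hx)
  have hd1 : Differentiable ℝ f := hf.differentiable (by norm_num)
  have hd2 : Differentiable ℝ (fderiv ℝ f) :=
    (hf.fderiv_right (m := 1) (by norm_num)).differentiable (by norm_num)
  have hn : ∀ y ∈ s, ‖fderiv ℝ (fderiv ℝ f) y‖ ≤ C := by
    intro y hy
    have h2 := hC y hy
    rwa [← norm_iteratedFDeriv_fderiv, norm_iteratedFDeriv_one] at h2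
  have hlip : ∀ y ∈ segment ℝ x (x + z), ‖fderiv ℝ f y - fderiv ℝ f x‖ ≤ C * ‖z‖ := by
    intro y hy
    have hy' := hs.segment_subset hx hz hy
    refine (hs.norm_image_sub_le_of_norm_fderiv_le (fun w _ => hd2 w) hn hx hy').trans ?_
    gcongr
    obtain ⟨t, ht, rfl⟩ := (segment_eq_image' ℝ x (x + z) ▸ hy)
    simp only [add_sub_cancel_left, norm_smul, Real.norm_eq_abs, abs_of_nonneg ht.1]
    exact mul_le_of_le_one_left (norm_nonneg _) ht.2
  have := (convex_segment x (x + z)).norm_image_sub_le_of_norm_fderiv_le' (fun w _ => hd1 w) hlip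
    (left_mem_segment ℝ x (x + z)) (right_mem_segment ℝ x (x + z))
  rw [add_sub_cancel_left, Real.norm_eq_abs] at this
  refine this.trans (le_of_eq (by ring))

theorem exists_bound_iteratedFDeriv {f : Rd d → ℝ} (hf : ContDiff ℝ 2 f) (R : ℝ) :
    ∃ C : ℝ, 0 ≤ C ∧ ∀ y ∈ Metric.closedBall (0 : Rd d) R, ‖iteratedFDeriv ℝ 2 f y‖ ≤ C := by
  obtain ⟨C, hC⟩ := (isCompact_closedBall (0 : Rd d) R).exists_bound_of_continuousOn
    (hf.continuous_iteratedFDeriv (m := 2) le_rfl).continuousOn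
  exact ⟨max C 0, le_max_right _ _, fun y hy => (hC y hy).trans (le_max_left _ _)⟩

/-- Second-order bound of the jump integrand, uniform over a ball. -/
theorem exists_abs_jumpIntegrand_le {f : Rd d → Fin m → ℝ} {i : Fin m}
    (hf : ContDiff ℝ 2 fun y => f y i) (R : ℝ) :
    ∃ A : ℝ, 0 ≤ A ∧ ∀ x : Rd d, ‖x‖ ≤ R → ∀ z : Rd d, ‖z‖ < 1 →
      |Coeffs.jumpIntegrand f x i z| ≤ A * ‖z‖ ^ 2 := by
  obtain ⟨A, hA, h⟩ := exists_bound_iteratedFDeriv hf (R + 1)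
  refine ⟨A, hA, fun x hx z hz => ?_⟩
  have := abs_sub_sub_fderiv_le hf (convex_closedBall (0 : Rd d) (R + 1)) (x := x) (z := z)
    (by rw [mem_closedBall_zero_iff]; linarith)
    (by rw [mem_closedBall_zero_iff]; linarith [norm_add_le x z]) h
  simpa [Coeffs.jumpIntegrand, hz] using this

namespace Coeffs

theorem measurable_jumpIntegrand {f : Rd d → Fin m → ℝ} {i : Fin m}
    (hf : Continuous fun y => f y i) (x : Rd d) : Measurable (jumpIntegrand f x i) := by
  unfold jumpIntegrand
  refine ((hf.comp (continuous_const.add continuous_id)).measurable.sub_const _).sub ?_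
  exact Measurable.ite (measurableSet_lt measurable_norm measurable_const)
    (ContinuousLinearMap.measurable _) measurable_const

theorem Standing.exists_bigjump {c : Coeffs d m} (hc : c.Standing) :
    ∃ C : ℝ, 0 ≤ C ∧ ∀ x i, c.jump x i (Metric.ball (0 : Rd d) 1)ᶜ ≤ ENNReal.ofReal C := by
  obtain ⟨C, hC, h⟩ := hc.bigjump_bdd
  exact ⟨C.toReal, ENNReal.toReal_nonneg, fun x i => by
    rw [ENNReal.ofReal_toReal hC.ne]; exact h x i⟩

theorem Standing.measure_bigjump_ne_top {c : Coeffs d m} (hc : c.Standing) (x : Rd d) (i : Fin m) :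
    c.jump x i (Metric.ball (0 : Rd d) 1)ᶜ ≠ ⊤ := by
  obtain ⟨C, -, h⟩ := hc.exists_bigjump
  exact ((h x i).trans_lt ENNReal.ofReal_lt_top).ne

theorem Standing.integrableOn_sq {c : Coeffs d m} (hc : c.Standing) (x : Rd d) (i : Fin m) :
    IntegrableOn (fun z : Rd d => ‖z‖ ^ 2) (Metric.ball 0 1) (c.jump x i) := by
  obtain ⟨C, -, h⟩ := hc.smalljump
  refine ⟨(by fun_prop : Continuous fun z : Rd d => ‖z‖ ^ 2).aestronglyMeasurable, ?_⟩
  rw [hasFiniteIntegral_iff_ofReal (ae_of_all _ fun z => by positivity)]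
  exact (h x i).trans_lt ENNReal.ofReal_lt_top

theorem Standing.exists_integral_sq_le {c : Coeffs d m} (hc : c.Standing) :
    ∃ C : ℝ, 0 ≤ C ∧ ∀ x i, ∫ z in Metric.ball (0 : Rd d) 1, ‖z‖ ^ 2 ∂(c.jump x i)
      ≤ C * (1 + ‖x‖ ^ 2) := by
  obtain ⟨C, hC, h⟩ := hc.smalljump
  refine ⟨C, hC.le, fun x i => ?_⟩
  rw [integral_eq_lintegral_of_nonneg_ae (ae_of_all _ fun z => by positivity)
    (hc.integrableOn_sq x i).1]
  exact ENNReal.toReal_le_of_le_ofReal (by positivity) (h x i)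

/-- Integrability against the jump measure, from separate control of small and big jumps. -/
theorem Standing.integrable_of_small_big {c : Coeffs d m} (hc : c.Standing) {x : Rd d} {i : Fin m}
    {g : Rd d → ℝ} (hg : Measurable g) {A : ℝ} (hA : ∀ z, ‖z‖ < 1 → |g z| ≤ A * ‖z‖ ^ 2)
    (hbig : IntegrableOn g (Metric.ball 0 1)ᶜ (c.jump x i)) : Integrable g (c.jump x i) := by
  rw [← integrableOn_univ, ← union_compl_self (Metric.ball (0 : Rd d) 1)]
  refine IntegrableOn.union ?_ hbig
  refine ((hc.integrableOn_sq x i).const_mul A).mono' hg.aestronglyMeasurable ?_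
  filter_upwards [ae_restrict_mem Metric.isOpen_ball.measurableSet] with z hz
  exact hA z (by simpa using hz)

theorem Standing.integrable_jumpIntegrand {c : Coeffs d m} (hc : c.Standing)
    {f : Rd d → Fin m → ℝ} {x : Rd d} {i : Fin m} (hf : ContDiff ℝ 2 fun y => f y i)
    (hbig : IntegrableOn (fun z => f (x + z) i) (Metric.ball 0 1)ᶜ (c.jump x i)) :
    Integrable (jumpIntegrand f x i) (c.jump x i) := by
  obtain ⟨A, -, hA⟩ := exists_abs_jumpIntegrand_le hf ‖x‖
  refine hc.integrable_of_small_big (measurable_jumpIntegrand hf.continuous x) (hA x le_rfl) ?_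
  refine (hbig.sub (integrableOn_const (C := f x i) (hc.measure_bigjump_ne_top x i))).congr_fun
    (fun z hz => ?_) Metric.isOpen_ball.measurableSet.compl
  have : ¬ ‖z‖ < 1 := by simpa using hz
  simp [jumpIntegrand, this]

theorem Standing.integrable_jumpIntegrand_of_bounded {c : Coeffs d m} (hc : c.Standing)
    {f : Rd d → Fin m → ℝ} {i : Fin m} (hf : ContDiff ℝ 2 fun y => f y i) {B : ℝ}
    (hB : ∀ y, |f y i| ≤ B) (x : Rd d) :
    Integrable (jumpIntegrand f x i) (c.jump x i) := by
  refine hc.integrable_jumpIntegrand hf ?_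
  refine Integrable.mono' (integrableOn_const (C := B) (hc.measure_bigjump_ne_top x i))
    (hf.continuous.comp (continuous_const.add continuous_id)).aestronglyMeasurable
    (ae_of_all _ fun z => hB _)

theorem integral_eq_small_add_big {μ : Measure (Rd d)} {g : Rd d → ℝ} (hg : Integrable g μ) :
    ∫ z, g z ∂μ = (∫ z in Metric.ball (0 : Rd d) 1, g z ∂μ)
      + ∫ z in (Metric.ball (0 : Rd d) 1)ᶜ, g z ∂μ :=
  (integral_add_compl Metric.isOpen_ball.measurableSet hg).symm

/-- Upper bound for the small-jump part. -/
theorem Standing.exists_small_le {c : Coeffs d m} (hc : c.Standing) :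
    ∃ C : ℝ, 0 ≤ C ∧ ∀ x i (g : Rd d → ℝ) (A : ℝ), 0 ≤ A → Integrable g (c.jump x i) →
      (∀ z, ‖z‖ < 1 → g z ≤ A * ‖z‖ ^ 2) →
      ∫ z in Metric.ball (0 : Rd d) 1, g z ∂(c.jump x i) ≤ A * (C * (1 + ‖x‖ ^ 2)) := by
  obtain ⟨C, hC, h⟩ := hc.exists_integral_sq_le
  refine ⟨C, hC, fun x i g A hA hg hgA => ?_⟩
  calc ∫ z in Metric.ball (0 : Rd d) 1, g z ∂(c.jump x i)
      ≤ ∫ z in Metric.ball (0 : Rd d) 1, A * ‖z‖ ^ 2 ∂(c.jump x i) :=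
        setIntegral_mono_on hg.integrableOn ((hc.integrableOn_sq x i).const_mul A)
          Metric.isOpen_ball.measurableSet fun z hz => hgA z (by simpa using hz)
    _ = A * ∫ z in Metric.ball (0 : Rd d) 1, ‖z‖ ^ 2 ∂(c.jump x i) := integral_const_mul _ _
    _ ≤ _ := by gcongr; exact h x i

/-- Upper bound for an integral against the jump measure. -/
theorem Standing.exists_integral_jump_le {c : Coeffs d m} (hc : c.Standing) :
    ∃ C : ℝ, 0 ≤ C ∧ ∀ x i (g : Rd d → ℝ) (A B : ℝ), 0 ≤ A → 0 ≤ B → Integrable g (c.jump x i) →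
      (∀ z, ‖z‖ < 1 → g z ≤ A * ‖z‖ ^ 2) → (∀ z, 1 ≤ ‖z‖ → g z ≤ B) →
      ∫ z, g z ∂(c.jump x i) ≤ C * (A * (1 + ‖x‖ ^ 2) + B) := by
  obtain ⟨C, hC, h⟩ := hc.exists_small_le
  obtain ⟨C', hC', h'⟩ := hc.exists_bigjump
  refine ⟨max C C', hC.trans (le_max_left _ _), fun x i g A B hA hB hg hgA hgB => ?_⟩
  have h1 := h x i g A hA hg hgA
  have h2 : ∫ z in (Metric.ball (0 : Rd d) 1)ᶜ, g z ∂(c.jump x i) ≤ C' * B := by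
    calc _ ≤ ∫ z in (Metric.ball (0 : Rd d) 1)ᶜ, B ∂(c.jump x i) :=
          setIntegral_mono_on hg.integrableOn (integrableOn_const (hc.measure_bigjump_ne_top x i))
            Metric.isOpen_ball.measurableSet.compl fun z hz => hgB z (by simpa using hz)
      _ ≤ C' * B := by
          rw [setIntegral_const, smul_eq_mul]
          gcongr
          exact ENNReal.toReal_le_of_le_ofReal hC' (h' x i)
  rw [integral_eq_small_add_big hg]
  have h3 : A * (C * (1 + ‖x‖ ^ 2)) ≤ max C C' * (A * (1 + ‖x‖ ^ 2)) := by
    rw [mul_left_comm]; gcongr; exact le_max_left _ _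
  have h4 : C' * B ≤ max C C' * B := by gcongr; exact le_max_right _ _
  linarith


theorem jumpIntegrand_add_const_mul {f g : Rd d → Fin m → ℝ} {i : Fin m}
    (hf : ContDiff ℝ 2 fun y => f y i) (hg : ContDiff ℝ 2 fun y => g y i) (s K : ℝ) (x z : Rd d) :
    jumpIntegrand (fun y j => f y j + s * g y j + K) x i z =
      jumpIntegrand f x i z + s * jumpIntegrand g x i z := by
  have hf1 : DifferentiableAt ℝ (fun y => f y i) x := hf.differentiable (by norm_num) x
  have hg1 : DifferentiableAt ℝ (fun y => g y i) x := hg.differentiable (by norm_num) x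
  unfold jumpIntegrand
  split_ifs
  · rw [fderiv_add_const, fderiv_fun_add hf1 (hg1.const_mul s), fderiv_const_mul hg1]
    simp; ring
  · ring

theorem integrable_jumpIntegrand_add_const_mul {c : Coeffs d m} {f g : Rd d → Fin m → ℝ}
    {i : Fin m} (hf : ContDiff ℝ 2 fun y => f y i) (hg : ContDiff ℝ 2 fun y => g y i) (s K : ℝ)
    {x : Rd d} (hfi : Integrable (jumpIntegrand f x i) (c.jump x i))
    (hgi : Integrable (jumpIntegrand g x i) (c.jump x i)) :
    Integrable (jumpIntegrand (fun y j => f y j + s * g y j + K) x i) (c.jump x i) := by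
  rw [show jumpIntegrand (fun y j => f y j + s * g y j + K) x i = fun z =>
    jumpIntegrand f x i z + s * jumpIntegrand g x i z from
    funext fun z => jumpIntegrand_add_const_mul hf hg s K x z]
  exact hfi.add (hgi.const_mul s)

/-- Linearity of the generator, modulo constants. -/
theorem Standing.G_add_const_mul {c : Coeffs d m} (hc : c.Standing) {f g : Rd d → Fin m → ℝ}
    {i : Fin m} (hf : ContDiff ℝ 2 fun y => f y i) (hg : ContDiff ℝ 2 fun y => g y i) (s K : ℝ)
    {x : Rd d} (hfi : Integrable (jumpIntegrand f x i) (c.jump x i))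
    (hgi : Integrable (jumpIntegrand g x i) (c.jump x i)) :
    c.G (fun y j => f y j + s * g y j + K) x i = c.G f x i + s * c.G g x i := by
  have hf1 : Differentiable ℝ (fun y => f y i) := hf.differentiable (by norm_num)
  have hg1 : Differentiable ℝ (fun y => g y i) := hg.differentiable (by norm_num)
  have hf2 : DifferentiableAt ℝ (fderiv ℝ (fun y => f y i)) x :=
    (hf.fderiv_right (m := 1) (by norm_num)).differentiable (by norm_num) x
  have hg2 : DifferentiableAt ℝ (fderiv ℝ (fun y => g y i)) x :=
    (hg.fderiv_right (m := 1) (by norm_num)).differentiable (by norm_num) x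
  have e1 : fderiv ℝ (fun y => f y i + s * g y i + K) =
      fun y => fderiv ℝ (fun y => f y i) y + s • fderiv ℝ (fun y => g y i) y := by
    funext y
    rw [fderiv_add_const, fderiv_fun_add (hf1 y) ((hg1 y).const_mul s), fderiv_const_mul (hg1 y)]
  have e2 : fderiv ℝ (fderiv ℝ (fun y => f y i + s * g y i + K)) x =
      fderiv ℝ (fderiv ℝ (fun y => f y i)) x + s • fderiv ℝ (fderiv ℝ (fun y => g y i)) x := by
    rw [e1, fderiv_fun_add hf2 (hg2.fun_const_smul s), fderiv_fun_const_smul hg2]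
  have e3 : ∫ z, jumpIntegrand (fun y j => f y j + s * g y j + K) x i z ∂(c.jump x i) =
      ∫ z, jumpIntegrand f x i z ∂(c.jump x i) + s * ∫ z, jumpIntegrand g x i z ∂(c.jump x i) := by
    simp_rw [jumpIntegrand_add_const_mul hf hg s K x]
    rw [integral_add hfi (hgi.const_mul s), integral_const_mul]
  have e4 : ∑ j, c.q x i j * (f x j + s * g x j + K) =
      ∑ j, c.q x i j * f x j + s * ∑ j, c.q x i j * g x j := by
    have : ∑ j, c.q x i j * K = 0 := by rw [← Finset.sum_mul, hc.q_rowsum, zero_mul]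
    simp_rw [mul_add, Finset.sum_add_distrib, this, Finset.mul_sum, add_zero]
    congr 1
    exact Finset.sum_congr rfl fun j _ => by ring
  unfold G
  simp only [iteratedFDeriv_two_apply]
  rw [e3, e4, e2, congrFun e1 x]
  simp only [add_apply, smul_apply, smul_eq_mul, mul_add,
    Finset.sum_add_distrib, Finset.mul_sum]
  have a1 : ∀ k l (A B : ℝ), 1 / 2 * (c.a x i k l * (s * A)) = s * (1 / 2 * (c.a x i k l * A)) :=
    fun k l A B => by ring
  have a2 : ∀ k (A : ℝ), c.b x i k * (s * A) = s * (c.b x i k * A) := fun k A => by ring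
  simp only [a2, fun k l A => a1 k l A 0]
  ring

theorem Standing.continuous_a {c : Coeffs d m} (hc : c.Standing) (i : Fin m) (k l : Fin d) :
    Continuous fun x => c.a x i k l := by
  have h := hc.sig_cont i
  unfold a
  exact (h.matrix_mul h.matrix_transpose).matrix_elem k l

theorem continuous_iteratedFDeriv_two_apply {f : Rd d → ℝ} (hf : ContDiff ℝ 2 f) (v w : Rd d) :
    Continuous fun x => iteratedFDeriv ℝ 2 f x ![v, w] := by
  have : Continuous (iteratedFDeriv ℝ 2 f) := hf.continuous_iteratedFDeriv (m := 2) le_rfl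
  fun_prop

theorem continuous_fderiv_const_apply {f : Rd d → ℝ} (hf : ContDiff ℝ 2 f) (v : Rd d) :
    Continuous fun x => fderiv ℝ f x v :=
  (hf.continuous_fderiv (by norm_num)).clm_apply continuous_const

theorem Standing.continuous_secondOrder {c : Coeffs d m} (hc : c.Standing) {f : Rd d → ℝ}
    (hf : ContDiff ℝ 2 f) (i : Fin m) :
    Continuous fun x => (1 / 2) * ∑ k, ∑ l, c.a x i k l * iteratedFDeriv ℝ 2 f x
        ![EuclideanSpace.single k (1 : ℝ), EuclideanSpace.single l (1 : ℝ)] :=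
  continuous_const.mul <| continuous_finsetSum _ fun k _ => continuous_finsetSum _ fun l _ =>
    (hc.continuous_a i k l).mul (continuous_iteratedFDeriv_two_apply hf _ _)

theorem Standing.continuous_firstOrder {c : Coeffs d m} (hc : c.Standing) {f : Rd d → ℝ}
    (hf : ContDiff ℝ 2 f) (i : Fin m) :
    Continuous fun x => ∑ k, c.b x i k * fderiv ℝ f x (EuclideanSpace.single k (1 : ℝ)) := by
  refine continuous_finsetSum _ fun k _ => Continuous.mul ?_ (continuous_fderiv_const_apply hf _)
  have := hc.b_cont i
  fun_prop

theorem Standing.measurable_integral_jumpIntegrand {c : Coeffs d m} (hc : c.Standing)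
    {f : Rd d → Fin m → ℝ} {i : Fin m} (hf : ContDiff ℝ 2 fun y => f y i) :
    Measurable fun x => ∫ z, jumpIntegrand f x i z ∂(c.jump x i) := by
  have h1 : ∀ x, ∫ z, jumpIntegrand f x i z ∂(c.jump x i) =
      ∫ z, c.pit x i z * jumpIntegrand f x i z := by
    intro x
    have hm : Measurable fun z => (c.pit x i z) :=
      (hc.pit_meas i).comp (measurable_const.prodMk measurable_id)
    unfold jump
    rw [integral_withDensity_eq_integral_toReal_smul hm.ennreal_ofReal
      (ae_of_all _ fun z => ENNReal.ofReal_lt_top)]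
    refine integral_congr_ae (ae_of_all _ fun z => ?_)
    simp [ENNReal.toReal_ofReal (hc.pit_nonneg x i z)]
  simp_rw [h1]
  refine (StronglyMeasurable.integral_prod_right' (ν := volume)
    (f := fun p : Rd d × Rd d => c.pit p.1 i p.2 * jumpIntegrand f p.1 i p.2) ?_).measurable
  refine Measurable.stronglyMeasurable ((hc.pit_meas i).mul ?_)
  unfold jumpIntegrand
  refine Measurable.sub (Continuous.measurable ?_) (Measurable.ite
    (measurableSet_lt measurable_snd.norm measurable_const) (Continuous.measurable ?_)
    measurable_const)
  · have := hf.continuous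
    exact (this.comp (continuous_fst.add continuous_snd)).sub (this.comp continuous_fst)
  · exact ((hf.continuous_fderiv (by norm_num)).comp continuous_fst).clm_apply continuous_snd

theorem Standing.measurable_G {c : Coeffs d m} (hc : c.Standing) {f : Rd d → Fin m → ℝ}
    (hf : ∀ i, ContDiff ℝ 2 fun y => f y i) :
    Measurable fun p : Rd d × Fin m => c.G f p.1 p.2 := by
  refine measurable_from_prod_countable_left fun i => ?_
  change Measurable fun x => c.G f x i
  unfold G
  refine (((hc.continuous_secondOrder (hf i) i).measurable.add
    (hc.continuous_firstOrder (hf i) i).measurable).add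
    (hc.measurable_integral_jumpIntegrand (hf i))).add ?_
  exact Finset.measurable_sum _ fun j _ => (hc.q_meas i j).mul (hf j).continuous.measurable

/-- The generator maps compactly supported `C²` functions to bounded functions. -/
theorem Standing.exists_abs_G_le {c : Coeffs d m} (hc : c.Standing) {f : Rd d → Fin m → ℝ}
    (hf : ∀ i, ContDiff ℝ 2 fun y => f y i) (hs : ∀ i, HasCompactSupport fun y => f y i) :
    ∃ C : ℝ, ∀ x i, |c.G f x i| ≤ C := by
  have hfb : ∀ i, ∃ B : ℝ, ∀ y, |f y i| ≤ B := fun i => by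
    simpa using (hs i).exists_bound_of_continuous (hf i).continuous
  choose B hB using hfb
  have key : ∀ i, ∃ C : ℝ, ∀ x, |c.G f x i| ≤ C := by
    intro i
    have hB0 : 0 ≤ B i := (abs_nonneg _).trans (hB i 0)
    obtain ⟨C1, h1⟩ := HasCompactSupport.exists_bound_of_continuous (f := fun x =>
      (1 / 2) * ∑ k, ∑ l, c.a x i k l * iteratedFDeriv ℝ 2 (fun y => f y i) x
        ![EuclideanSpace.single k (1 : ℝ), EuclideanSpace.single l (1 : ℝ)]) (by
        refine HasCompactSupport.mono' ((hs i).iteratedFDeriv (𝕜 := ℝ) 2) ?_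
        intro x hx
        refine subset_closure fun h0 => hx ?_
        simp [h0]) (hc.continuous_secondOrder (hf i) i)
    obtain ⟨C2, h2⟩ := HasCompactSupport.exists_bound_of_continuous (f := fun x =>
      ∑ k, c.b x i k * fderiv ℝ (fun y => f y i) x (EuclideanSpace.single k (1 : ℝ))) (by
        refine HasCompactSupport.mono' ((hs i).fderiv (𝕜 := ℝ)) ?_
        intro x hx
        refine subset_closure fun h0 => hx ?_
        simp [h0]) (hc.continuous_firstOrder (hf i) i)
    obtain ⟨R, hR0, hR⟩ := (hs i).isCompact.isBounded.exists_pos_norm_le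
    obtain ⟨A, hA0, hA⟩ := exists_abs_jumpIntegrand_le (hf i) (R + 1)
    obtain ⟨C3, hC3, h3⟩ := hc.exists_integral_jump_le
    have hsmall : ∀ x, ∃ A' : ℝ, 0 ≤ A' ∧ A' * (1 + ‖x‖ ^ 2) ≤ A * (1 + (R + 1) ^ 2) ∧
        ∀ z : Rd d, ‖z‖ < 1 → |jumpIntegrand f x i z| ≤ A' * ‖z‖ ^ 2 := by
      intro x
      by_cases hx : ‖x‖ ≤ R + 1
      · exact ⟨A, hA0, by gcongr, hA x hx⟩
      · refine ⟨0, le_rfl, by rw [zero_mul]; positivity, fun z hz => ?_⟩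
        have hzero : ∀ y : Rd d, R < ‖y‖ → y ∉ tsupport fun y => f y i := fun y hy hy' =>
          absurd (hR y hy') (not_le.2 hy)
        have n1 : R < ‖x‖ := by linarith
        have n2 : R < ‖x + z‖ := by
          have := norm_sub_le (x + z) z
          rw [add_sub_cancel_right] at this
          linarith
        have e1 : f x i = 0 := image_eq_zero_of_notMem_tsupport (f := fun y => f y i) (hzero x n1)
        have e2 : f (x + z) i = 0 :=
          image_eq_zero_of_notMem_tsupport (f := fun y => f y i) (hzero _ n2)
        have e3 : fderiv ℝ (fun y => f y i) x = 0 := by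
          by_contra h
          exact hzero x n1 (support_fderiv_subset ℝ h)
        simp [jumpIntegrand, e1, e2, e3]
    have hbig : ∀ (x z : Rd d), 1 ≤ ‖z‖ → |jumpIntegrand f x i z| ≤ 2 * B i := by
      intro x z hz
      simp only [jumpIntegrand, not_lt.2 hz, if_false, sub_zero]
      exact (abs_sub _ _).trans (by linarith [hB i (x + z), hB i x])
    have h3' : ∀ x, |∫ z, jumpIntegrand f x i z ∂(c.jump x i)| ≤
        C3 * (A * (1 + (R + 1) ^ 2) + 2 * B i) := by
      intro x
      have hint := hc.integrable_jumpIntegrand_of_bounded (hf i) (hB i) x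
      obtain ⟨A', hA', hle, hz⟩ := hsmall x
      have u1 := h3 x i _ A' (2 * B i) hA' (by positivity) hint
        (fun z h => (le_abs_self _).trans (hz z h)) (fun z h => (le_abs_self _).trans (hbig x z h))
      have u2 := h3 x i _ A' (2 * B i) hA' (by positivity) hint.neg
        (fun z h => (neg_le_abs _).trans (hz z h)) (fun z h => (neg_le_abs _).trans (hbig x z h))
      have u3 : C3 * (A' * (1 + ‖x‖ ^ 2) + 2 * B i) ≤ C3 * (A * (1 + (R + 1) ^ 2) + 2 * B i) := by
        gcongr
      simp only [Pi.neg_apply, integral_neg] at u2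
      exact abs_le.2 ⟨by linarith, by linarith⟩
    choose Cq hCq using hc.q_bdd i
    refine ⟨C1 + C2 + C3 * (A * (1 + (R + 1) ^ 2) + 2 * B i) + ∑ j, Cq j * B j, fun x => ?_⟩
    unfold G
    refine (abs_add_le _ _).trans (add_le_add ((abs_add_le _ _).trans (add_le_add
      ((abs_add_le _ _).trans (add_le_add (h1 x) (h2 x))) (h3' x))) ?_)
    refine (Finset.abs_sum_le_sum_abs _ _).trans (Finset.sum_le_sum fun j _ => ?_)
    rw [abs_mul]
    exact mul_le_mul (hCq j x) (hB j x) (abs_nonneg _) ((abs_nonneg _).trans (hCq j x))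
  choose C hC using key
  refine ⟨∑ i, |C i|, fun x i => (hC i x).trans ((le_abs_self _).trans ?_)⟩
  exact Finset.single_le_sum (f := fun i => |C i|) (fun j _ => abs_nonneg _) (Finset.mem_univ i)

theorem isCb2_of_hasCompactSupport {f : Rd d → Fin m → ℝ}
    (hf : ∀ i, ContDiff ℝ 2 fun y => f y i) (hs : ∀ i, HasCompactSupport fun y => f y i) :
    IsCb2 f := by
  refine ⟨hf, fun i => ?_⟩
  obtain ⟨C0, h0⟩ := (hs i).exists_bound_of_continuous (hf i).continuous
  obtain ⟨C1, h1⟩ := ((hs i).fderiv (𝕜 := ℝ)).exists_bound_of_continuous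
    ((hf i).continuous_fderiv (by norm_num))
  obtain ⟨C2, h2⟩ := ((hs i).iteratedFDeriv (𝕜 := ℝ) 2).exists_bound_of_continuous
    ((hf i).continuous_iteratedFDeriv (m := 2) le_rfl)
  refine ⟨max C0 (max C1 C2), fun x => ⟨(h0 x).trans (le_max_left _ _), (h1 x).trans ?_,
    (h2 x).trans ?_⟩⟩ <;> simp

end Coeffs

/-- The Gaussian barrier `exp(-p|x - x₀|²)`. -/
def gaussBarrier (p : ℝ) (x₀ x : Rd d) : ℝ := Real.exp (-p * ‖x - x₀‖ ^ 2)

theorem gaussBarrier_pos (p : ℝ) (x₀ x : Rd d) : 0 < gaussBarrier p x₀ x := Real.exp_pos _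

theorem gaussBarrier_le_one {p : ℝ} (hp : 0 ≤ p) (x₀ x : Rd d) : gaussBarrier p x₀ x ≤ 1 := by
  refine Real.exp_le_one_iff.2 ?_
  have : 0 ≤ p * ‖x - x₀‖ ^ 2 := by positivity
  linarith

theorem contDiff_gaussBarrier (p : ℝ) (x₀ : Rd d) : ContDiff ℝ 2 (gaussBarrier p x₀) := by
  unfold gaussBarrier
  exact (contDiff_const.mul ((contDiff_id.sub contDiff_const).norm_sq ℝ)).exp

theorem fderiv_gaussBarrier (p : ℝ) (x₀ x v : Rd d) :
    fderiv ℝ (gaussBarrier p x₀) x v = -2 * p * inner ℝ (x - x₀) v * gaussBarrier p x₀ x := by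
  have h1 : HasFDerivAt (fun y : Rd d => ‖y - x₀‖ ^ 2) _ x :=
    ((hasFDerivAt_id x).sub_const x₀).norm_sq
  have h2 : HasFDerivAt (gaussBarrier p x₀) _ x := (h1.const_mul (-p)).exp
  rw [h2.fderiv]
  simp [gaussBarrier, inner_sub_left]
  ring

theorem fderiv_fderiv_gaussBarrier (p : ℝ) (x₀ x v w : Rd d) :
    fderiv ℝ (fderiv ℝ (gaussBarrier p x₀)) x v w =
      (4 * p ^ 2 * inner ℝ (x - x₀) v * inner ℝ (x - x₀) w - 2 * p * inner ℝ v w)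
        * gaussBarrier p x₀ x := by
  have hd2 : DifferentiableAt ℝ (fderiv ℝ (gaussBarrier p x₀)) x :=
    ((contDiff_gaussBarrier p x₀).fderiv_right (m := 1) (by norm_num)).differentiable
      (by norm_num) x
  have e : fderiv ℝ (fderiv ℝ (gaussBarrier p x₀)) x v w =
      fderiv ℝ (fun y => fderiv ℝ (gaussBarrier p x₀) y w) x v := by
    rw [fderiv_clm_apply hd2 (differentiableAt_const w)]
    simp
  have hd1 : DifferentiableAt ℝ (gaussBarrier p x₀) x :=
    (contDiff_gaussBarrier p x₀).differentiable (by norm_num) x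
  have h1 : HasFDerivAt (fun y : Rd d => inner ℝ (y - x₀) w) _ x :=
    ((hasFDerivAt_id x).sub_const x₀).inner ℝ (hasFDerivAt_const w x)
  have h2 := (h1.const_mul (-2 * p)).fun_mul hd1.hasFDerivAt
  rw [e, show (fun y => fderiv ℝ (gaussBarrier p x₀) y w) = fun y =>
    -2 * p * inner ℝ (y - x₀) w * gaussBarrier p x₀ y from
    funext fun y => fderiv_gaussBarrier p x₀ y w, HasFDerivAt.fderiv h2]
  simp [fderiv_gaussBarrier, inner_sub_left]
  ring

theorem gaussBarrier_add_ge (p : ℝ) (x₀ x z : Rd d) :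
    -(p * gaussBarrier p x₀ x * ‖z‖ ^ 2) ≤
      gaussBarrier p x₀ (x + z) - gaussBarrier p x₀ x - fderiv ℝ (gaussBarrier p x₀) x z := by
  have e1 : ‖x + z - x₀‖ ^ 2 = ‖x - x₀‖ ^ 2 + 2 * inner ℝ (x - x₀) z + ‖z‖ ^ 2 := by
    rw [show x + z - x₀ = (x - x₀) + z by abel, norm_add_sq_real]
  have e2 : gaussBarrier p x₀ (x + z) =
      gaussBarrier p x₀ x * Real.exp (-p * (2 * inner ℝ (x - x₀) z + ‖z‖ ^ 2)) := by
    unfold gaussBarrier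
    rw [← Real.exp_add, e1]
    ring_nf
  have h := mul_le_mul_of_nonneg_left
    (Real.add_one_le_exp (-p * (2 * inner ℝ (x - x₀) z + ‖z‖ ^ 2))) (gaussBarrier_pos p x₀ x).le
  rw [fderiv_gaussBarrier, e2]
  linarith

namespace Coeffs

theorem sum_quadForm_nonneg (c : Coeffs d m) (x : Rd d) (i : Fin m) (ξ : Rd d) :
    0 ≤ ∑ k, ∑ l, ξ k * c.a x i k l * ξ l := by
  have : ∑ k, ∑ l, ξ k * c.a x i k l * ξ l = ∑ n, (∑ k, ξ k * c.sig x i k n) ^ 2 := by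
    simp only [a, Matrix.mul_apply, Matrix.transpose_apply, sq, Finset.sum_mul, Finset.mul_sum]
    rw [Finset.sum_comm' (t' := Finset.univ) (s' := fun _ => Finset.univ) (by simp)]
    rw [Finset.sum_congr rfl fun k _ => Finset.sum_comm]
    rw [Finset.sum_comm]
    refine Finset.sum_congr rfl fun n _ => Finset.sum_congr rfl fun k _ =>
      Finset.sum_congr rfl fun l _ => by ring
  rw [this]
  positivity

theorem trace_a_le (c : Coeffs d m) (x : Rd d) (i : Fin m) :
    ∑ k, c.a x i k k ≤ (∑ k, ∑ l, |c.sig x i k l|) ^ 2 := by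
  have h1 : ∀ k, c.a x i k k ≤ (∑ l, |c.sig x i k l|) ^ 2 := by
    intro k
    simp only [a, Matrix.mul_apply, Matrix.transpose_apply]
    calc ∑ l, c.sig x i k l * c.sig x i k l = ∑ l, |c.sig x i k l| ^ 2 :=
          Finset.sum_congr rfl fun l _ => by rw [sq_abs, sq]
      _ ≤ _ := Finset.sum_sq_le_sq_sum_of_nonneg fun l _ => abs_nonneg _
  exact (Finset.sum_le_sum fun k _ => h1 k).trans
    (Finset.sum_sq_le_sq_sum_of_nonneg fun k _ => by positivity)

/-- Lower bound for the generator applied to the Gaussian barrier. -/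
theorem Standing.exists_le_G_gaussBarrier {c : Coeffs d m} (hc : c.Standing) (x₀ : Rd d) :
    ∃ K : ℝ, 0 ≤ K ∧ ∀ p : ℝ, 1 ≤ p → ∀ (x : Rd d) (i : Fin m) (κ : ℝ),
      κ * ‖x - x₀‖ ^ 2 ≤ ∑ k, ∑ l, (x - x₀) k * c.a x i k l * (x - x₀) l →
      gaussBarrier p x₀ x * (2 * p ^ 2 * κ * ‖x - x₀‖ ^ 2 - p * K * (1 + ‖x - x₀‖ ^ 2)) ≤
        c.G (fun y _ => gaussBarrier p x₀ y) x i := by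
  obtain ⟨C, hC, hgr⟩ := hc.growth
  obtain ⟨C', hC', hJ⟩ := hc.exists_integral_jump_le
  set N := ‖x₀‖ with hN
  have hN0 : 0 ≤ N := norm_nonneg _
  refine ⟨(2 * C ^ 2 + 3 * C + 2 * C') * (3 + 2 * N ^ 2), by positivity,
    fun p hp x i κ hκ => ?_⟩
  set u := gaussBarrier p x₀ x with hu
  have hu0 : 0 < u := gaussBarrier_pos p x₀ x
  have hp0 : 0 < p := by linarith
  set r := ‖x - x₀‖ with hr
  have hr0 : 0 ≤ r := norm_nonneg _
  have hxn : ‖x‖ ^ 2 ≤ 2 * r ^ 2 + 2 * N ^ 2 := by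
    have : ‖x‖ ≤ r + N := by
      have := norm_add_le (x - x₀) x₀
      rwa [sub_add_cancel] at this
    have h0 := norm_nonneg x
    nlinarith [sq_nonneg (r - N)]
  have hx1 : 1 + ‖x‖ ^ 2 ≤ (3 + 2 * N ^ 2) * (1 + r ^ 2) := by
    nlinarith [mul_nonneg (sq_nonneg N) (sq_nonneg r), sq_nonneg r]
  have hr1 : r ^ 2 ≤ (3 + 2 * N ^ 2) * (1 + r ^ 2) := by
    nlinarith [mul_nonneg (sq_nonneg N) (sq_nonneg r), sq_nonneg r, sq_nonneg N]
  have hSig0 : 0 ≤ ∑ k, ∑ l, |c.sig x i k l| := by positivity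
  have hB0 : 0 ≤ ∑ k, |c.b x i k| := by positivity
  have hg := hgr x i
  have hq2 : (1 + ‖x‖) ^ 2 ≤ 2 * (1 + ‖x‖ ^ 2) := by nlinarith [sq_nonneg (1 - ‖x‖)]
  have htr : ∑ k, c.a x i k k ≤ 2 * C ^ 2 * (1 + ‖x‖ ^ 2) := by
    refine (c.trace_a_le x i).trans ?_
    calc (∑ k, ∑ l, |c.sig x i k l|) ^ 2 ≤ (C * (1 + ‖x‖)) ^ 2 := by gcongr; linarith
      _ = C ^ 2 * (1 + ‖x‖) ^ 2 := by ring
      _ ≤ C ^ 2 * (2 * (1 + ‖x‖ ^ 2)) := by gcongr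
      _ = _ := by ring
  have hb : ∑ k, c.b x i k * (x - x₀) k ≤ C * (1 + ‖x‖) * r := by
    calc ∑ k, c.b x i k * (x - x₀) k ≤ ∑ k, |c.b x i k| * r := by
          refine Finset.sum_le_sum fun k _ => (le_abs_self _).trans ?_
          rw [abs_mul]
          gcongr
          exact PiLp.norm_apply_le (x - x₀) k
      _ = (∑ k, |c.b x i k|) * r := by rw [Finset.sum_mul]
      _ ≤ _ := by gcongr; linarith
  have hb2 : 2 * (C * (1 + ‖x‖) * r) ≤ C * (2 * (1 + ‖x‖ ^ 2) + r ^ 2) := by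
    have : 2 * ((1 + ‖x‖) * r) ≤ 2 * (1 + ‖x‖ ^ 2) + r ^ 2 := by
      nlinarith [sq_nonneg (1 + ‖x‖ - r)]
    nlinarith
  have hcd := contDiff_gaussBarrier p x₀
  have hint := hc.integrable_jumpIntegrand_of_bounded (f := fun y _ => gaussBarrier p x₀ y)
    (i := i) hcd (B := 1) (fun y => by
      rw [abs_of_pos (gaussBarrier_pos p x₀ y)]; exact gaussBarrier_le_one hp0.le x₀ y) x
  have hj := hJ x i _ (p * u) u (by positivity) hu0.le hint.neg
    (fun z hz => by
      have := gaussBarrier_add_ge p x₀ x z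
      simp only [Pi.neg_apply, jumpIntegrand, hz, if_true]
      linarith)
    (fun z hz => by
      simp only [Pi.neg_apply, jumpIntegrand, not_lt.2 hz, if_false]
      linarith [gaussBarrier_pos p x₀ (x + z)])
  simp only [Pi.neg_apply, integral_neg] at hj
  have hq : ∑ j, c.q x i j * gaussBarrier p x₀ x = 0 := by
    rw [← Finset.sum_mul, hc.q_rowsum, zero_mul]
  have e2 : ∑ k, ∑ l, c.a x i k l * fderiv ℝ (fderiv ℝ (gaussBarrier p x₀)) x
      (EuclideanSpace.single k (1 : ℝ)) (EuclideanSpace.single l (1 : ℝ)) =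
      u * (4 * p ^ 2 * ∑ k, ∑ l, (x - x₀) k * c.a x i k l * (x - x₀) l
        - 2 * p * ∑ k, c.a x i k k) := by
    have s1 : ∀ k, ∑ l, c.a x i k l * fderiv ℝ (fderiv ℝ (gaussBarrier p x₀)) x
        (EuclideanSpace.single k (1 : ℝ)) (EuclideanSpace.single l (1 : ℝ)) =
        u * (4 * p ^ 2 * ∑ l, (x - x₀) k * c.a x i k l * (x - x₀) l
          - 2 * p * c.a x i k k) := by
      intro k
      have s2 : ∀ l, c.a x i k l * fderiv ℝ (fderiv ℝ (gaussBarrier p x₀)) x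
          (EuclideanSpace.single k (1 : ℝ)) (EuclideanSpace.single l (1 : ℝ)) =
          u * (4 * p ^ 2 * ((x - x₀) k * c.a x i k l * (x - x₀) l))
            - u * (2 * p * (if k = l then c.a x i k l else 0)) := by
        intro l
        rw [fderiv_fderiv_gaussBarrier]
        simp only [EuclideanSpace.inner_single_right, PiLp.single_apply, conj_trivial, one_mul]
        by_cases hkl : k = l
        · subst hkl; simp only [if_true]; ring
        · simp only [hkl, Ne.symm hkl, if_false]; ring
      rw [Finset.sum_congr rfl fun l _ => s2 l, Finset.sum_sub_distrib, ← Finset.mul_sum,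
        ← Finset.mul_sum, ← Finset.mul_sum, ← Finset.mul_sum]
      simp
      ring
    rw [Finset.sum_congr rfl fun k _ => s1 k, ← Finset.mul_sum, Finset.sum_sub_distrib,
      ← Finset.mul_sum, ← Finset.mul_sum]
  have e1 : ∑ k, c.b x i k * fderiv ℝ (gaussBarrier p x₀) x (EuclideanSpace.single k (1 : ℝ)) =
      u * (-2 * p * ∑ k, c.b x i k * (x - x₀) k) := by
    rw [Finset.mul_sum, Finset.mul_sum]
    refine Finset.sum_congr rfl fun k _ => ?_
    rw [fderiv_gaussBarrier]
    simp only [EuclideanSpace.inner_single_right, conj_trivial, one_mul]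
    ring
  unfold G
  simp only [iteratedFDeriv_two_apply, Matrix.cons_val_zero, Matrix.cons_val_one]
  rw [hq]
  change _ ≤ 1 / 2 * ∑ k, ∑ l, c.a x i k l * fderiv ℝ (fderiv ℝ (gaussBarrier p x₀)) x
      (EuclideanSpace.single k (1 : ℝ)) (EuclideanSpace.single l (1 : ℝ))
    + ∑ k, c.b x i k * fderiv ℝ (gaussBarrier p x₀) x (EuclideanSpace.single k (1 : ℝ)) + _ + 0
  rw [e2, e1]
  set Qf := ∑ k, ∑ l, (x - x₀) k * c.a x i k l * (x - x₀) l
  set T := ∑ k, c.a x i k k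
  set Bf := ∑ k, c.b x i k * (x - x₀) k
  set J := ∫ z, jumpIntegrand (fun y _ => gaussBarrier p x₀ y) x i z ∂(c.jump x i)
  have j1 : -(u * (p * (2 * C' * (1 + ‖x‖ ^ 2)))) ≤ J := by
    have : C' * (p * u * (1 + ‖x‖ ^ 2) + u) ≤ u * (p * (2 * C' * (1 + ‖x‖ ^ 2))) := by
      have : u ≤ p * u * (1 + ‖x‖ ^ 2) := by
        have : 1 ≤ p * (1 + ‖x‖ ^ 2) := by nlinarith [sq_nonneg ‖x‖]
        nlinarith
      have := mul_le_mul_of_nonneg_left this hC'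
      linarith
    linarith
  have main : 2 * p ^ 2 * κ * r ^ 2 - p * ((2 * C ^ 2 + 3 * C + 2 * C') * (3 + 2 * N ^ 2)) *
      (1 + r ^ 2) ≤ 2 * p ^ 2 * Qf - p * T - 2 * p * Bf - p * (2 * C' * (1 + ‖x‖ ^ 2)) := by
    have m1 : 2 * p ^ 2 * (κ * r ^ 2) ≤ 2 * p ^ 2 * Qf := by gcongr
    have m2 : T + 2 * Bf + 2 * C' * (1 + ‖x‖ ^ 2) ≤
        (2 * C ^ 2 + 3 * C + 2 * C') * ((3 + 2 * N ^ 2) * (1 + r ^ 2)) := by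
      have t1 := mul_le_mul_of_nonneg_left hx1 (by positivity : 0 ≤ 2 * C ^ 2 + 2 * C + 2 * C')
      have t2 := mul_le_mul_of_nonneg_left hr1 hC.le
      linarith
    have m3 := mul_le_mul_of_nonneg_left m2 hp0.le
    linarith
  have := mul_le_mul_of_nonneg_left main hu0.le
  linarith


/-- Far jump densities from nearby points are comparable (chaining of the comparability
condition along a segment). -/
theorem Standing.exists_pit_le {c : Coeffs d m} (hc : c.Standing) (y : Rd d) {R : ℝ} (hR : 0 < R) :
    ∃ C : ℝ, 0 ≤ C ∧ ∀ x : Rd d, ‖x - y‖ < R → ∀ z : Rd d, R + 1 ≤ ‖z - y‖ → ∀ i,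
      c.pit x i (z - x) ≤ C * c.pit y i (z - y) := by
  obtain ⟨κ₂, -, β, -, h⟩ := hc.comparability
  obtain ⟨α, hα1, -, hα⟩ := h (1 / 2) (by norm_num)
  have hα0 : 0 ≤ α := by linarith
  obtain ⟨n, hn⟩ := exists_nat_gt (4 * R)
  have hn0 : (0 : ℝ) < n := by linarith
  refine ⟨α ^ n, by positivity, fun x hx z hz i => ?_⟩
  have key : ∀ k : ℕ, k ≤ n → c.pit (y + ((k : ℝ) / n) • (x - y)) i
      (z - (y + ((k : ℝ) / n) • (x - y))) ≤ α ^ k * c.pit y i (z - y) := by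
    intro k
    induction k with
    | zero => intro _; simp
    | succ k ih =>
      intro hk
      refine (hα (y + ((k : ℝ) / n) • (x - y)) _ (y + ((k : ℝ) / n) • (x - y)) z i ?_ ?_ ?_).trans
        ((mul_le_mul_of_nonneg_left (ih (by omega)) hα0).trans (le_of_eq (by ring)))
      · rw [mem_ball_iff_norm, add_sub_add_left_eq_sub, ← sub_smul, norm_smul]
        have : (((k + 1 : ℕ) : ℝ) / n - (k : ℝ) / n) = 1 / n := by push_cast; ring
        rw [this, Real.norm_eq_abs, abs_of_pos (by positivity), one_div_mul_eq_div,
          div_lt_iff₀ hn0]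
        linarith
      · exact Metric.mem_ball_self (by norm_num)
      · rw [mem_ball_iff_norm, not_lt]
        have hk1 : (k : ℝ) / n ≤ 1 := by
          rw [div_le_one hn0]; exact_mod_cast (by omega : k ≤ n)
        have h1 : ‖((k : ℝ) / n) • (x - y)‖ ≤ R := by
          rw [norm_smul, Real.norm_eq_abs, abs_of_nonneg (by positivity)]
          nlinarith [norm_nonneg (x - y)]
        have h2 := norm_sub_norm_le (z - y) (((k : ℝ) / n) • (x - y))
        rw [sub_sub] at h2
        linarith
  have := key n le_rfl
  rwa [div_self hn0.ne', one_smul, add_sub_cancel] at this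

theorem Standing.setLIntegral_jump {c : Coeffs d m} (hc : c.Standing) (x : Rd d) (i : Fin m)
    {g : Rd d → ℝ≥0∞} (hg : Measurable g) {s : Set (Rd d)} (hs : MeasurableSet s) :
    ∫⁻ z in s, g z ∂(c.jump x i) = ∫⁻ z in s, ENNReal.ofReal (c.pit x i z) * g z := by
  have hm : Measurable fun z => ENNReal.ofReal (c.pit x i z) :=
    ((hc.pit_meas i).comp (measurable_const.prodMk measurable_id)).ennreal_ofReal
  unfold jump
  rw [setLIntegral_withDensity_eq_setLIntegral_mul _ hm hg hs]
  rfl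

/-- If a nonnegative continuous function is integrable against the big jumps from one point, then
it is so, uniformly, from all points of a ball. -/
theorem Standing.exists_lintegral_big_le {c : Coeffs d m} (hc : c.Standing) {v : Rd d → ℝ}
    (hv : Continuous v) (y : Rd d) (i : Fin m) {R : ℝ} (hR : 0 < R)
    (hy : ∫⁻ z in (Metric.ball (0 : Rd d) 1)ᶜ, ENNReal.ofReal (v (y + z)) ∂(c.jump y i) ≠ ⊤) :
    ∃ C : ℝ≥0∞, C ≠ ⊤ ∧ ∀ x : Rd d, ‖x - y‖ < R →
      ∫⁻ z in (Metric.ball (0 : Rd d) 1)ᶜ, ENNReal.ofReal (v (x + z)) ∂(c.jump x i) ≤ C := by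
  obtain ⟨C, hC, hpit⟩ := hc.exists_pit_le y hR
  obtain ⟨Cb, -, hCb⟩ := hc.exists_bigjump
  obtain ⟨B, hB⟩ := (isCompact_closedBall y (R + 1)).exists_bound_of_continuousOn hv.continuousOn
  set L := ∫⁻ z in (Metric.ball (0 : Rd d) 1)ᶜ, ENNReal.ofReal (v (y + z)) ∂(c.jump y i)
  have hball : MeasurableSet (Metric.ball (0 : Rd d) 1)ᶜ :=
    Metric.isOpen_ball.measurableSet.compl
  have hvm : ∀ w : Rd d, Measurable fun z => ENNReal.ofReal (v (w + z)) := fun w =>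
    (hv.comp (continuous_const.add continuous_id)).measurable.ennreal_ofReal
  refine ⟨ENNReal.ofReal Cb * ENNReal.ofReal B + ENNReal.ofReal C * L, by finiteness,
    fun x hx => ?_⟩
  let S : Set (Rd d) := {w | R + 1 ≤ ‖w - y‖}
  let F : Rd d → ℝ≥0∞ := S.indicator fun w =>
    ENNReal.ofReal C * (ENNReal.ofReal (c.pit y i (w - y)) * ENNReal.ofReal (v w))
  have hpx : Measurable fun z => ENNReal.ofReal (c.pit x i z) :=
    ((hc.pit_meas i).comp (measurable_const.prodMk measurable_id)).ennreal_ofReal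
  have hpt : ∀ z, ENNReal.ofReal (c.pit x i z) * ENNReal.ofReal (v (x + z)) ≤
      ENNReal.ofReal (c.pit x i z) * ENNReal.ofReal B + F (x + z) := by
    intro z
    by_cases hz : x + z ∈ S
    · refine le_trans ?_ le_add_self
      simp only [F, indicator_of_mem hz]
      rw [← mul_assoc, ← ENNReal.ofReal_mul hC]
      gcongr
      have := hpit x hx (x + z) hz i
      rwa [add_sub_cancel_left] at this
    · refine le_trans ?_ le_self_add
      gcongr
      refine (le_abs_self _).trans (hB (x + z) ?_)
      rw [mem_closedBall_iff_norm]
      exact (not_le.1 hz).le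
  have hFint : ∫⁻ z, F (x + z) ≤ ENNReal.ofReal C * L := by
    rw [lintegral_add_left_eq_self F x, ← lintegral_add_left_eq_self F y]
    have : ∀ z, F (y + z) ≤ ENNReal.ofReal C * (Metric.ball (0 : Rd d) 1)ᶜ.indicator
        (fun z => ENNReal.ofReal (c.pit y i z) * ENNReal.ofReal (v (y + z))) z := by
      intro z
      by_cases hz : y + z ∈ S
      · have hz' : z ∈ (Metric.ball (0 : Rd d) 1)ᶜ := by
          have : R + 1 ≤ ‖z‖ := by simpa [S] using hz
          simp; linarith
        simp [F, indicator_of_mem hz, indicator_of_mem hz']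
      · simp [F, indicator_of_notMem hz]
    refine (lintegral_mono this).trans ?_
    rw [lintegral_const_mul' _ _ ENNReal.ofReal_ne_top, lintegral_indicator hball,
      ← hc.setLIntegral_jump y i (hvm y) hball]
  calc ∫⁻ z in (Metric.ball (0 : Rd d) 1)ᶜ, ENNReal.ofReal (v (x + z)) ∂(c.jump x i)
      = ∫⁻ z in (Metric.ball (0 : Rd d) 1)ᶜ,
          ENNReal.ofReal (c.pit x i z) * ENNReal.ofReal (v (x + z)) :=
        hc.setLIntegral_jump x i (hvm x) hball
    _ ≤ ∫⁻ z in (Metric.ball (0 : Rd d) 1)ᶜ,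
          (ENNReal.ofReal (c.pit x i z) * ENNReal.ofReal B + F (x + z)) :=
        lintegral_mono hpt
    _ = (∫⁻ z in (Metric.ball (0 : Rd d) 1)ᶜ, ENNReal.ofReal (c.pit x i z) * ENNReal.ofReal B) +
          ∫⁻ z in (Metric.ball (0 : Rd d) 1)ᶜ, F (x + z) :=
        lintegral_add_left (hpx.mul_const _) _
    _ ≤ ENNReal.ofReal Cb * ENNReal.ofReal B + ENNReal.ofReal C * L := by
        refine add_le_add ?_ ((setLIntegral_le_lintegral _ _).trans hFint)
        rw [← hc.setLIntegral_jump x i measurable_const hball, lintegral_const, mul_comm,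
          Measure.restrict_apply_univ]
        gcongr
        exact hCb x i

/-- If `V ≥ 0` is of class `C²` and has a convergent jump integral at one point, then `GV` is
well defined and bounded above on bounded sets. -/
theorem Standing.exists_G_le {c : Coeffs d m} (hc : c.Standing) {V : Rd d → Fin m → ℝ}
    (hV : ∀ i, ContDiff ℝ 2 fun y => V y i) (hV0 : ∀ x i, 0 ≤ V x i) (y : Rd d)
    (hy : ∀ i, Integrable (jumpIntegrand V y i) (c.jump y i)) {R : ℝ} (hR : 0 < R) :
    ∃ K : ℝ, 0 ≤ K ∧ ∀ x : Rd d, ‖x - y‖ < R → ∀ i,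
      Integrable (jumpIntegrand V x i) (c.jump x i) ∧ c.G V x i ≤ K := by
  have hball : MeasurableSet (Metric.ball (0 : Rd d) 1)ᶜ :=
    Metric.isOpen_ball.measurableSet.compl
  have key : ∀ i, ∃ K : ℝ, ∀ x : Rd d, ‖x - y‖ < R →
      Integrable (jumpIntegrand V x i) (c.jump x i) ∧ c.G V x i ≤ K := by
    intro i
    have hcont : ∀ w : Rd d, Continuous fun z => V (w + z) i := fun w =>
      (hV i).continuous.comp (continuous_const.add continuous_id)
    have hyfin : ∫⁻ z in (Metric.ball (0 : Rd d) 1)ᶜ, ENNReal.ofReal (V (y + z) i) ∂(c.jump y i)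
        ≠ ⊤ := by
      have h1 : IntegrableOn (fun z => V (y + z) i) (Metric.ball (0 : Rd d) 1)ᶜ (c.jump y i) := by
        refine ((hy i).integrableOn.add (integrableOn_const (C := V y i)
          (hc.measure_bigjump_ne_top y i))).congr_fun (fun z hz => ?_) hball
        have : ¬ ‖z‖ < 1 := by simpa using hz
        simp [jumpIntegrand, this]
      exact ((hasFiniteIntegral_iff_ofReal (ae_of_all _ fun z => hV0 _ _)).1 h1.2).ne
    obtain ⟨C, hC, hbig⟩ := hc.exists_lintegral_big_le (hV i).continuous y i hR hyfin
    obtain ⟨Cs, hCs, hsmall⟩ := hc.exists_small_le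
    obtain ⟨A, hA0, hA⟩ := exists_abs_jumpIntegrand_le (hV i) (‖y‖ + R)
    have hcpt := isCompact_closedBall y R
    obtain ⟨C1, h1⟩ := hcpt.exists_bound_of_continuousOn
      (hc.continuous_secondOrder (hV i) i).continuousOn
    obtain ⟨C2, h2⟩ := hcpt.exists_bound_of_continuousOn
      (hc.continuous_firstOrder (hV i) i).continuousOn
    choose B hB using fun j => hcpt.exists_bound_of_continuousOn (hV j).continuous.continuousOn
    choose Cq hCq using hc.q_bdd i
    refine ⟨C1 + C2 + (A * (Cs * (1 + (‖y‖ + R) ^ 2)) + C.toReal) + ∑ j, Cq j * B j,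
      fun x hx => ?_⟩
    have hxm : x ∈ Metric.closedBall y R := by rw [mem_closedBall_iff_norm]; exact hx.le
    have hxn : ‖x‖ ≤ ‖y‖ + R := by
      have := norm_add_le (x - y) y
      rw [sub_add_cancel] at this
      linarith
    have hVbig : IntegrableOn (fun z => V (x + z) i) (Metric.ball (0 : Rd d) 1)ᶜ (c.jump x i) := by
      refine ⟨(hcont x).aestronglyMeasurable, ?_⟩
      rw [hasFiniteIntegral_iff_ofReal (ae_of_all _ fun z => hV0 _ _)]
      exact (hbig x hx).trans_lt hC.lt_top
    have hint := hc.integrable_jumpIntegrand (hV i) hVbig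
    refine ⟨hint, ?_⟩
    have hJ : ∫ z, jumpIntegrand V x i z ∂(c.jump x i) ≤
        A * (Cs * (1 + (‖y‖ + R) ^ 2)) + C.toReal := by
      rw [integral_eq_small_add_big hint]
      refine add_le_add ?_ ?_
      · refine (hsmall x i _ A hA0 hint fun z hz => (le_abs_self _).trans (hA x hxn z hz)).trans ?_
        gcongr
      · calc ∫ z in (Metric.ball (0 : Rd d) 1)ᶜ, jumpIntegrand V x i z ∂(c.jump x i)
            ≤ ∫ z in (Metric.ball (0 : Rd d) 1)ᶜ, V (x + z) i ∂(c.jump x i) := by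
              refine setIntegral_mono_on hint.integrableOn hVbig hball fun z hz => ?_
              have : ¬ ‖z‖ < 1 := by simpa using hz
              simp [jumpIntegrand, this, hV0]
          _ ≤ C.toReal := by
              rw [integral_eq_lintegral_of_nonneg_ae (ae_of_all _ fun z => hV0 _ _)
                (hcont x).aestronglyMeasurable]
              exact ENNReal.toReal_mono hC (hbig x hx)
    unfold G
    refine add_le_add (add_le_add (add_le_add ((le_abs_self _).trans (h1 x hxm))
      ((le_abs_self _).trans (h2 x hxm))) hJ) (Finset.sum_le_sum fun j _ => ?_)
    refine (le_abs_self _).trans ?_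
    rw [abs_mul]
    exact mul_le_mul (hCq j x) (hB j x hxm) (abs_nonneg _) ((abs_nonneg _).trans (hCq j x))
  choose K hK using key
  refine ⟨∑ i, |K i|, by positivity, fun x hx i => ⟨(hK i x hx).1, (hK i x hx).2.trans
    ((le_abs_self _).trans ?_)⟩⟩
  exact Finset.single_le_sum (f := fun i => |K i|) (fun j _ => abs_nonneg _) (Finset.mem_univ i)


theorem isConnected_ball (x₀ : Rd d) {r : ℝ} (hr : 0 < r) : IsConnected (Metric.ball x₀ r) :=
  ⟨⟨x₀, Metric.mem_ball_self hr⟩, (convex_ball x₀ r).isPreconnected⟩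

theorem exists_notMem_of_isBounded (hd : 1 ≤ d) {D : Set (Rd d)} (hD : Bornology.IsBounded D) :
    ∃ y, y ∉ D := by
  have : Nonempty (Fin d) := ⟨⟨0, hd⟩⟩
  have : Nontrivial (Rd d) := inferInstance
  by_contra! h
  exact NormedSpace.unbounded_univ ℝ (Rd d) (by rwa [← eq_univ_of_forall h])

theorem one_add_sq_mul_exp_le {p r R : ℝ} (hp : 1 ≤ p) (hR : 0 ≤ R) (hr : 2 * R ≤ r) :
    (1 + r ^ 2) * Real.exp (-p * r ^ 2) ≤ 2 * Real.exp (-p * R ^ 2) := by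
  have h1 : -p * r ^ 2 ≤ -(r ^ 2 / 2) + -p * R ^ 2 := by
    have : R ^ 2 ≤ r ^ 2 / 4 := by nlinarith
    nlinarith [sq_nonneg r]
  have h2 : (1 + r ^ 2) * Real.exp (-(r ^ 2 / 2)) ≤ 2 := by
    rw [Real.exp_neg, ← div_eq_mul_inv, div_le_iff₀ (Real.exp_pos _)]
    nlinarith [Real.add_one_le_exp (r ^ 2 / 2), sq_nonneg r]
  calc (1 + r ^ 2) * Real.exp (-p * r ^ 2)
      ≤ (1 + r ^ 2) * Real.exp (-(r ^ 2 / 2) + -p * R ^ 2) := by gcongr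
    _ = (1 + r ^ 2) * Real.exp (-(r ^ 2 / 2)) * Real.exp (-p * R ^ 2) := by
        rw [Real.exp_add]; ring
    _ ≤ _ := by gcongr

/-- Ellipticity allows the exceptional set of a Lyapunov function to be shrunk to a small ball. -/
theorem Standing.exists_lyapunov_ball {c : Coeffs d m} (hc : c.Standing) (hd : 1 ≤ d)
    {D : Set (Rd d)} (hD : Bornology.IsBounded D) {V : Rd d → Fin m → ℝ} (hV : c.IsLyapC1 D V)
    (x₀ : Rd d) {ρ : ℝ} (hρ : 0 < ρ) :
    ∃ (W : Rd d → Fin m → ℝ) (K : ℝ), 0 ≤ K ∧ (∀ i, ContDiff ℝ 2 fun y => W y i) ∧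
      (∀ x i, 0 ≤ W x i) ∧ ∀ x i, Integrable (jumpIntegrand W x i) (c.jump x i) ∧ c.G W x i ≤ K ∧
        (x ∉ Metric.ball x₀ ρ → c.G W x i ≤ -(1 / 2)) := by
  obtain ⟨hV2, hV0, hVG⟩ := hV
  obtain ⟨y, hy⟩ := exists_notMem_of_isBounded hd hD
  obtain ⟨R₁, hR₁, hDy⟩ := hD.subset_ball_lt 0 y
  obtain ⟨KV, hKV, hKVG⟩ := hc.exists_G_le hV2 hV0 y (fun i => (hVG y hy i).1) hR₁
  have hVint : ∀ x i, Integrable (jumpIntegrand V x i) (c.jump x i) := fun x i => by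
    by_cases hx : x ∈ D
    · exact (hKVG x (mem_ball_iff_norm.1 (hDy hx)) i).1
    · exact (hVG x hx i).1
  have hVD : ∀ x ∈ D, ∀ i, c.G V x i ≤ KV := fun x hx i =>
    (hKVG x (mem_ball_iff_norm.1 (hDy hx)) i).2
  obtain ⟨R, hR, hDR⟩ := hD.subset_ball_lt 0 x₀
  obtain ⟨κ, ⟨hκ0, -⟩, hκ⟩ := hc.ellipticity (Metric.ball x₀ (2 * R))
    ⟨Metric.isOpen_ball, isConnected_ball x₀ (by positivity), Metric.isBounded_ball⟩
  obtain ⟨Kg, hKg, hg⟩ := hc.exists_le_G_gaussBarrier x₀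
  obtain ⟨p, hp1, hp2, hp3⟩ : ∃ p : ℝ, 1 ≤ p ∧ Kg * (1 + 4 * R ^ 2) ≤ p * (κ * ρ ^ 2) ∧
      4 * (KV + 1) * Kg ≤ p * (κ * ρ ^ 2) := by
    have hκρ : 0 < κ * ρ ^ 2 := by positivity
    refine ⟨max 1 (max (Kg * (1 + 4 * R ^ 2) / (κ * ρ ^ 2)) (4 * (KV + 1) * Kg / (κ * ρ ^ 2))),
      le_max_left _ _, ?_, ?_⟩
    · rw [← div_le_iff₀ hκρ]; exact (le_max_left _ _).trans (le_max_right _ _)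
    · rw [← div_le_iff₀ hκρ]; exact (le_max_right _ _).trans (le_max_right _ _)
  have hp0 : 0 < p := by linarith
  set E := Real.exp (-p * R ^ 2) with hE
  have hE0 : 0 < E := Real.exp_pos _
  set θ := p ^ 2 * (κ * ρ ^ 2) * E with hθ
  have hθ0 : 0 < θ := by positivity
  set N := (KV + 1) / θ with hN
  have hN0 : 0 < N := by positivity
  have hNθ : N * θ = KV + 1 := div_mul_cancel₀ _ hθ0.ne'
  let u : Rd d → Fin m → ℝ := fun y _ => gaussBarrier p x₀ y
  have hu2 : ∀ i, ContDiff ℝ 2 fun y => u y i := fun i => contDiff_gaussBarrier p x₀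
  have hu0 : ∀ y, 0 < gaussBarrier p x₀ y := gaussBarrier_pos p x₀
  have hu1 : ∀ y, gaussBarrier p x₀ y ≤ 1 := gaussBarrier_le_one hp0.le x₀
  have huint : ∀ x i, Integrable (jumpIntegrand u x i) (c.jump x i) := fun x i =>
    hc.integrable_jumpIntegrand_of_bounded (hu2 i) (B := 1)
      (fun y => by rw [abs_of_pos (hu0 y)]; exact hu1 y) x
  have hlow : ∀ x i, -(p * Kg * ((1 + ‖x - x₀‖ ^ 2) * gaussBarrier p x₀ x)) ≤ c.G u x i := by
    intro x i
    have := hg p hp1 x i 0 (by rw [zero_mul]; exact c.sum_quadForm_nonneg x i _)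
    refine le_trans (le_of_eq ?_) this
    ring
  have hin : ∀ x i, x ∈ Metric.ball x₀ (2 * R) → x ∉ Metric.ball x₀ ρ →
      p ^ 2 * (κ * ρ ^ 2) * gaussBarrier p x₀ x ≤ c.G u x i := by
    intro x i hx hxρ
    have h1 := hg p hp1 x i κ (hκ x hx i _).1
    refine le_trans ?_ h1
    rw [mem_ball_iff_norm] at hx hxρ
    have hr : ρ ^ 2 ≤ ‖x - x₀‖ ^ 2 := by
      have := not_lt.1 hxρ
      gcongr
    have hr2 : ‖x - x₀‖ ^ 2 ≤ 4 * R ^ 2 := by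
      have := pow_le_pow_left₀ (norm_nonneg _) hx.le 2
      linarith
    rw [mul_comm (gaussBarrier p x₀ x)]
    refine mul_le_mul_of_nonneg_right ?_ (hu0 x).le
    have s1 : 2 * p ^ 2 * κ * ρ ^ 2 ≤ 2 * p ^ 2 * κ * ‖x - x₀‖ ^ 2 := by gcongr
    have s2 : p * Kg * (1 + ‖x - x₀‖ ^ 2) ≤ p * (Kg * (1 + 4 * R ^ 2)) := by
      rw [mul_assoc]; gcongr
    have s3 := mul_le_mul_of_nonneg_left hp2 hp0.le
    linarith
  have hGW : ∀ x i, c.G (fun y j => V y j + (-N) * u y j + N) x i =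
      c.G V x i + (-N) * c.G u x i := fun x i =>
    hc.G_add_const_mul (hV2 i) (hu2 i) (-N) N (hVint x i) (huint x i)
  have hlow2 : ∀ x i, -(p * Kg * 2) ≤ c.G u x i := by
    intro x i
    refine le_trans (neg_le_neg ?_) (hlow x i)
    gcongr
    have := one_add_sq_mul_exp_le hp1 le_rfl (r := ‖x - x₀‖) (R := 0) (by simp)
    simpa [gaussBarrier] using this
  have hoff : ∀ x i, x ∉ Metric.ball x₀ ρ →
      c.G (fun y j => V y j + (-N) * u y j + N) x i ≤ -(1 / 2) := by
    intro x i hxρ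
    rw [hGW]
    by_cases hx2 : x ∈ Metric.ball x₀ (2 * R)
    · have h1 := hin x i hx2 hxρ
      by_cases hxD : x ∈ D
      · have hxR := hDR hxD
        rw [mem_ball_iff_norm] at hxR
        have hEu : E ≤ gaussBarrier p x₀ x := by
          refine Real.exp_le_exp.2 ?_
          have := pow_le_pow_left₀ (norm_nonneg _) hxR.le 2
          nlinarith
        have h2 : θ ≤ c.G u x i := le_trans (by rw [hθ]; gcongr) h1
        have h3 := mul_le_mul_of_nonneg_left h2 hN0.le
        linarith [hVD x hxD i]
      · have h2 : 0 ≤ c.G u x i :=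
          le_trans (mul_nonneg (by positivity) (hu0 x).le) h1
        have h3 := mul_nonneg hN0.le h2
        linarith [(hVG x hxD i).2]
    · have hxD : x ∉ D := fun h => hx2 (Metric.ball_subset_ball (by linarith) (hDR h))
      rw [mem_ball_iff_norm, not_lt] at hx2
      have h1 := one_add_sq_mul_exp_le hp1 hR.le hx2
      have h2 : -(p * Kg * (2 * E)) ≤ c.G u x i := by
        refine le_trans (neg_le_neg ?_) (hlow x i)
        exact mul_le_mul_of_nonneg_left h1 (by positivity)
      have h3 := mul_le_mul_of_nonneg_left h2 hN0.le
      have h4 : N * (p * Kg * (2 * E)) ≤ 1 / 2 := by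
        rw [hN, div_mul_eq_mul_div, div_le_iff₀ hθ0, hθ]
        have := mul_le_mul_of_nonneg_left hp3 (by positivity : 0 ≤ p * E / 2)
        linarith
      linarith [(hVG x hxD i).2]
  refine ⟨fun y j => V y j + (-N) * u y j + N, KV + N * (p * Kg * 2), by positivity,
    fun i => ((hV2 i).add (contDiff_const.mul (hu2 i))).add contDiff_const, fun x i => ?_,
    fun x i => ⟨integrable_jumpIntegrand_add_const_mul (hV2 i) (hu2 i) _ _ (hVint x i)
      (huint x i), ?_, hoff x i⟩⟩
  · have := mul_le_mul_of_nonneg_left (hu1 x) hN0.le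
    have h0 := hV0 x i
    simp only [u]
    linarith
  · rw [hGW]
    have h1 : c.G V x i ≤ KV := by
      by_cases hx : x ∈ D
      · exact hVD x hx i
      · linarith [(hVG x hx i).2]
    have h2 := mul_le_mul_of_nonneg_left (hlow2 x i) hN0.le
    linarith

/-- Strict irreducibility allows the exceptional set to be reduced to one discrete state. -/
theorem Standing.exists_lyapunov_singleton {c : Coeffs d m} (hc : c.Standing) (hd : 1 ≤ d)
    {D : Set (Rd d)} (hD : BddDomain D) (hirr : c.StrictIrred D) (hC1 : c.C1 D) (l : Fin m) :
    ∃ W : Rd d → Fin m → ℝ, (∀ i, ContDiff ℝ 2 fun y => W y i) ∧ (∀ x i, 0 ≤ W x i) ∧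
      ∀ x i, ¬ (x ∈ D ∧ i = l) →
        Integrable (jumpIntegrand W x i) (c.jump x i) ∧ c.G W x i ≤ -(1 / 2) := by
  obtain ⟨hDo, ⟨⟨x₀, hx₀⟩, -⟩, hDb⟩ := hD
  obtain ⟨V, hV⟩ := hC1
  obtain ⟨ε, hε, hεD⟩ := Metric.nhds_basis_closedBall.mem_iff.1 (hDo.mem_nhds hx₀)
  have hρ : 0 < ε / 2 := by positivity
  obtain ⟨V1, K, hK, hV2, hV0, hVG⟩ := hc.exists_lyapunov_ball hd hDb hV x₀ hρ
  let φ : ContDiffBump x₀ := ⟨ε / 2, ε, hρ, by linarith⟩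
  have hφ2 : ContDiff ℝ 2 φ := φ.contDiff
  let h : Rd d → Fin m → ℝ := fun y j => if j = l then φ y else 0
  have hh2 : ∀ i, ContDiff ℝ 2 fun y => h y i := by
    intro i
    by_cases hi : i = l
    · simpa [h, hi] using hφ2
    · simpa [h, hi] using contDiff_const
  have hh01 : ∀ y i, 0 ≤ h y i ∧ h y i ≤ 1 := by
    intro y i
    by_cases hi : i = l
    · simp [h, hi, φ.nonneg, φ.le_one]
    · simp [h, hi]
  have hhint : ∀ x i, Integrable (jumpIntegrand h x i) (c.jump x i) := fun x i =>
    hc.integrable_jumpIntegrand_of_bounded (hh2 i) (B := 1)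
      (fun y => by rw [abs_of_nonneg (hh01 y i).1]; exact (hh01 y i).2) x
  have hGne : ∀ x i, i ≠ l → c.G h x i = c.q x i l * φ x := by
    intro x i hi
    simp [G, jumpIntegrand, h, hi]
  have hGl : ∀ x, x ∉ D → 0 ≤ c.G h x l := by
    intro x hx
    have hts : x ∉ tsupport φ := by
      rw [φ.tsupport_eq]
      exact fun hx' => hx (hεD hx')
    have e0 : φ x = 0 := image_eq_zero_of_notMem_tsupport hts
    have e1 : fderiv ℝ φ x = 0 := by
      by_contra hne
      exact hts (support_fderiv_subset ℝ hne)
    have e2 : iteratedFDeriv ℝ 2 φ x = 0 := by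
      by_contra hne
      exact hts (support_iteratedFDeriv_subset (𝕜 := ℝ) 2 hne)
    have e3 : ∀ j, c.q x l j * h x j = 0 := fun j => by
      by_cases hj : j = l
      · simp [h, hj, e0]
      · simp [h, hj]
    have hl : (fun y => h y l) = φ := by funext y; simp [h]
    have e4 : 0 ≤ ∫ z, jumpIntegrand h x l z ∂(c.jump x l) := by
      refine integral_nonneg fun z => ?_
      simp only [jumpIntegrand, hl, e1]
      simpa [h, e0] using φ.nonneg
    unfold G
    rw [hl, e1, e2, Finset.sum_congr rfl fun j _ => e3 j]
    simpa using e4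
  obtain ⟨q0, hq0, hq⟩ : ∃ q0 > (0 : ℝ), ∀ i, i ≠ l → ∀ x ∈ D, q0 ≤ c.q x i l := by
    have : ∀ i, ∃ q0 > (0 : ℝ), i ≠ l → ∀ x ∈ D, q0 ≤ c.q x i l := fun i => by
      by_cases hi : i = l
      · exact ⟨1, one_pos, fun h => absurd hi h⟩
      · obtain ⟨q0, h1, h2⟩ := hirr i l hi
        exact ⟨q0, h1, fun _ => h2⟩
    choose q0 h1 h2 using this
    have : Nonempty (Fin m) := ⟨l⟩
    obtain ⟨i₀, hi₀⟩ := Finite.exists_min q0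
    exact ⟨q0 i₀, h1 i₀, fun i hi x hx => (hi₀ i).trans (h2 i hi x hx)⟩
  set N := (K + 1 / 2) / q0 with hN
  have hN0 : 0 ≤ N := by positivity
  have hNq : N * q0 = K + 1 / 2 := div_mul_cancel₀ _ hq0.ne'
  refine ⟨fun y j => V1 y j + (-N) * h y j + N,
    fun i => ((hV2 i).add (contDiff_const.mul (hh2 i))).add contDiff_const, fun x i => ?_,
    fun x i hxi => ⟨integrable_jumpIntegrand_add_const_mul (hV2 i) (hh2 i) _ _ (hVG x i).1
      (hhint x i), ?_⟩⟩
  · have := mul_le_mul_of_nonneg_left (hh01 x i).2 hN0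
    have h0 := hV0 x i
    linarith
  · rw [hc.G_add_const_mul (hV2 i) (hh2 i) (-N) N (hVG x i).1 (hhint x i)]
    by_cases hi : i = l
    · subst hi
      have hxD : x ∉ D := fun hx => hxi ⟨hx, rfl⟩
      have hxb : x ∉ Metric.ball x₀ (ε / 2) := fun hx =>
        hxD (hεD (Metric.ball_subset_closedBall (Metric.ball_subset_ball (by linarith) hx)))
      have h1 := mul_nonneg hN0 (hGl x hxD)
      linarith [(hVG x i).2.2 hxb]
    · by_cases hxb : x ∈ Metric.ball x₀ (ε / 2)
      · have hxD : x ∈ D :=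
          hεD (Metric.ball_subset_closedBall (Metric.ball_subset_ball (by linarith) hxb))
        have hφx : φ x = 1 := φ.one_of_mem_closedBall (Metric.ball_subset_closedBall hxb)
        rw [hGne x i hi, hφx, mul_one]
        have := mul_le_mul_of_nonneg_left (hq i hi x hxD) hN0
        linarith [(hVG x i).2.1]
      · have h1 : 0 ≤ c.G h x i := by
          rw [hGne x i hi]
          exact mul_nonneg (hc.q_nonneg x i l hi) φ.nonneg
        have h2 := mul_nonneg hN0 h1
        linarith [(hVG x i).2.2 hxb]

end Coeffs

section Grid

variable {Ω α : Type*} (Z : ℝ≥0 → Ω → α) (O : Set α)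

/-- The event that `Z` avoids `O` at the grid times `0, δ, …, kδ`. -/
def gridAvoid (δ : ℝ≥0) (k : ℕ) : Set Ω := {ω | ∀ j ≤ k, Z (j * δ) ω ∉ O}

/-- The hitting time of `O` along the grid `0, δ, …, nδ`, capped at `nδ`. -/
def gridTime (δ : ℝ≥0) (n : ℕ) (ω : Ω) : ℝ :=
  ∑ k ∈ Finset.range n, (gridAvoid Z O δ k).indicator (fun _ => (δ : ℝ)) ω

/-- The hitting time of `O`, capped at `T`. -/
def cappedHit (T : ℝ≥0) (ω : Ω) : ℝ := (min (hitTime Z O ω) T).toReal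

variable {Z O}

theorem min_hitTime_ne_top (T : ℝ≥0) (ω : Ω) : min (hitTime Z O ω) T ≠ ⊤ :=
  ((min_le_right _ _).trans_lt ENNReal.coe_lt_top).ne

theorem cappedHit_nonneg (T : ℝ≥0) (ω : Ω) : 0 ≤ cappedHit Z O T ω := ENNReal.toReal_nonneg

theorem ofReal_cappedHit (T : ℝ≥0) (ω : Ω) :
    ENNReal.ofReal (cappedHit Z O T ω) = min (hitTime Z O ω) T :=
  ENNReal.ofReal_toReal (min_hitTime_ne_top T ω)

theorem cappedHit_le (T : ℝ≥0) (ω : Ω) : cappedHit Z O T ω ≤ T :=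
  ENNReal.toReal_mono ENNReal.coe_ne_top (min_le_right _ _)

theorem notMem_of_lt_cappedHit {T t : ℝ≥0} {ω : Ω} (h : (t : ℝ) < cappedHit Z O T ω) :
    Z t ω ∉ O := by
  intro ht
  have h1 : hitTime Z O ω ≤ t := iInf₂_le t ht
  have h2 : cappedHit Z O T ω ≤ t :=
    ENNReal.toReal_mono ENNReal.coe_ne_top ((min_le_left _ _).trans h1)
  linarith

theorem exists_hit_of_cappedHit_lt {T : ℝ≥0} {ω : Ω} (h : cappedHit Z O T ω < T) {η : ℝ}
    (hη : 0 < η) : ∃ t : ℝ≥0, Z t ω ∈ O ∧ (t : ℝ) < cappedHit Z O T ω + η := by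
  have hlt : hitTime Z O ω < T := by
    by_contra hge
    rw [cappedHit, min_eq_right (not_lt.1 hge)] at h
    exact lt_irrefl _ h
  have heq : ENNReal.ofReal (cappedHit Z O T ω) = hitTime Z O ω := by
    rw [ofReal_cappedHit, min_eq_left hlt.le]
  have h1 : hitTime Z O ω < ENNReal.ofReal (cappedHit Z O T ω + η) := by
    rw [← heq]
    exact (ENNReal.ofReal_lt_ofReal_iff (by linarith [cappedHit_nonneg (Z := Z) (O := O) T ω])).2
      (by linarith)
  unfold hitTime at h1
  simp only [iInf_lt_iff] at h1
  obtain ⟨t, ht, h2⟩ := h1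
  refine ⟨t, ht, ?_⟩
  rw [ENNReal.ofReal, ENNReal.coe_lt_coe] at h2
  exact (Real.lt_toNNReal_iff_coe_lt).1 h2

theorem mem_gridAvoid_of_lt {T δ : ℝ≥0} {k : ℕ} {ω : Ω} (h : k * (δ : ℝ) < cappedHit Z O T ω) :
    ω ∈ gridAvoid Z O δ k := by
  intro j hj
  refine notMem_of_lt_cappedHit (T := T) (lt_of_le_of_lt ?_ h)
  push_cast
  gcongr

theorem gridTime_succ (δ : ℝ≥0) (n : ℕ) (ω : Ω) : gridTime Z O δ (n + 1) ω =
    gridTime Z O δ n ω + (gridAvoid Z O δ n).indicator (fun _ => (δ : ℝ)) ω :=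
  Finset.sum_range_succ _ _

theorem indicator_delta_nonneg (s : Set Ω) (δ : ℝ≥0) (ω : Ω) :
    0 ≤ s.indicator (fun _ => (δ : ℝ)) ω :=
  indicator_nonneg (fun _ _ => δ.2) ω

theorem indicator_delta_le (s : Set Ω) (δ : ℝ≥0) (ω : Ω) :
    s.indicator (fun _ => (δ : ℝ)) ω ≤ δ :=
  indicator_le_self' (fun _ _ => δ.2) ω

theorem gridTime_nonneg (δ : ℝ≥0) (n : ℕ) (ω : Ω) : 0 ≤ gridTime Z O δ n ω :=
  Finset.sum_nonneg fun _ _ => indicator_delta_nonneg _ _ _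

theorem gridTime_le (δ : ℝ≥0) (n : ℕ) (ω : Ω) : gridTime Z O δ n ω ≤ n * δ := by
  refine (Finset.sum_le_sum fun k _ => indicator_delta_le _ _ _).trans ?_
  simp

theorem min_cappedHit_le_gridTime (T δ : ℝ≥0) (n : ℕ) (ω : Ω) :
    min (cappedHit Z O T ω) (n * δ) ≤ gridTime Z O δ n ω := by
  induction n with
  | zero => simp [gridTime]
  | succ n ih =>
    rw [gridTime_succ]
    rcases le_or_gt (cappedHit Z O T ω) (n * δ) with h | h
    · rw [min_eq_left h] at ih
      exact (min_le_left _ _).trans (by linarith [indicator_delta_nonneg (gridAvoid Z O δ n) δ ω])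
    · rw [min_eq_right h.le] at ih
      rw [indicator_of_mem (mem_gridAvoid_of_lt h)]
      refine (min_le_right _ _).trans ?_
      push_cast
      linarith

theorem gridTime_le_of_hit {δ : ℝ≥0} {j : ℕ} {ω : Ω} (h : Z (j * δ) ω ∈ O) (n : ℕ) :
    gridTime Z O δ n ω ≤ j * δ := by
  induction n with
  | zero => simp only [gridTime, Finset.range_zero, Finset.sum_empty]; positivity
  | succ n ih =>
    rcases le_or_gt j n with hj | hj
    · rw [gridTime_succ, indicator_of_notMem (fun hω : ω ∈ gridAvoid Z O δ n => hω j hj h)]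
      linarith
    · refine (gridTime_le δ (n + 1) ω).trans ?_
      gcongr
      exact hj

theorem tendsto_gridTime [TopologicalSpace α] (hO : IsOpen O) {ω : Ω}
    (hZ : ∀ t, ContinuousWithinAt (fun s => Z s ω) (Ici t) t) (T : ℝ≥0) :
    Tendsto (fun n : ℕ => gridTime Z O (T / (n + 1 : ℕ)) (n + 1) ω) atTop
      (𝓝 (cappedHit Z O T ω)) := by
  have hmul : ∀ n : ℕ, ((n + 1 : ℕ) : ℝ) * ((T / (n + 1 : ℕ) : ℝ≥0) : ℝ) = T := by
    intro n
    push_cast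
    field_simp
  have hlow : ∀ n : ℕ, cappedHit Z O T ω ≤ gridTime Z O (T / (n + 1 : ℕ)) (n + 1) ω := by
    intro n
    have := min_cappedHit_le_gridTime (Z := Z) (O := O) T (T / (n + 1 : ℕ)) (n + 1) ω
    rwa [hmul, min_eq_left (cappedHit_le T ω)] at this
  have hupT : ∀ n : ℕ, gridTime Z O (T / (n + 1 : ℕ)) (n + 1) ω ≤ T := by
    intro n
    have := gridTime_le (Z := Z) (O := O) (T / (n + 1 : ℕ)) (n + 1) ω
    rwa [hmul] at this
  refine tendsto_order.2 ⟨fun a ha => Eventually.of_forall fun n => ha.trans_le (hlow n),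
    fun a ha => ?_⟩
  rcases (cappedHit_le (Z := Z) (O := O) T ω).eq_or_lt with heq | hlt
  · exact Eventually.of_forall fun n => (hupT n).trans_lt (heq ▸ ha)
  obtain ⟨t, htO, hta⟩ := exists_hit_of_cappedHit_lt hlt (sub_pos.2 ha)
  rw [add_sub_cancel] at hta
  have hmem : ∀ᶠ s in 𝓝[≥] t, Z s ω ∈ O := (hZ t).eventually (hO.mem_nhds htO)
  have hδ : Tendsto (fun n : ℕ => T / (n + 1 : ℕ)) atTop (𝓝 (0 : ℝ≥0)) :=
    (tendsto_const_div_atTop_nhds_zero_nat T).comp (tendsto_add_atTop_nat 1)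
  have hTpos : 0 < T := by
    have := (cappedHit_nonneg (Z := Z) (O := O) T ω).trans_lt hlt
    exact_mod_cast this
  have hj1 : ∀ n : ℕ, t ≤ (⌈t / (T / (n + 1 : ℕ))⌉₊ : ℝ≥0) * (T / (n + 1 : ℕ)) := fun n => by
    have hpos : 0 < T / (n + 1 : ℕ) := by positivity
    rw [← div_le_iff₀ hpos]
    exact Nat.le_ceil _
  have hj2 : ∀ n : ℕ, (⌈t / (T / (n + 1 : ℕ))⌉₊ : ℝ≥0) * (T / (n + 1 : ℕ)) ≤
      t + T / (n + 1 : ℕ) := fun n => by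
    have hpos : 0 < T / (n + 1 : ℕ) := by positivity
    have := (Nat.ceil_lt_add_one (zero_le (a := t / (T / (n + 1 : ℕ))))).le
    calc _ ≤ (t / (T / (n + 1 : ℕ)) + 1) * (T / (n + 1 : ℕ)) := by gcongr
      _ = _ := by rw [add_mul, div_mul_cancel₀ _ hpos.ne', one_mul]
  have hlim : Tendsto (fun n : ℕ => (⌈t / (T / (n + 1 : ℕ))⌉₊ : ℝ≥0) * (T / (n + 1 : ℕ))) atTop
      (𝓝 t) := by
    refine tendsto_of_tendsto_of_tendsto_of_le_of_le tendsto_const_nhds ?_ hj1 hj2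
    simpa using (tendsto_const_nhds (x := t)).add hδ
  have hlim' := tendsto_nhdsWithin_iff (s := Ici t).2 ⟨hlim, Eventually.of_forall hj1⟩
  have hlimR : Tendsto (fun n : ℕ =>
      (((⌈t / (T / (n + 1 : ℕ))⌉₊ : ℝ≥0) * (T / (n + 1 : ℕ)) : ℝ≥0) : ℝ)) atTop (𝓝 (t : ℝ)) :=
    (NNReal.tendsto_coe).2 hlim
  filter_upwards [hlim'.eventually hmem, hlimR.eventually (gt_mem_nhds hta)] with n h1 h2
  refine (gridTime_le_of_hit h1 (n + 1)).trans_lt ?_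
  simpa using h2

/-- Pathwise comparison: the running integral stopped on the grid. -/
theorem sum_indicator_integral_le {T δ : ℝ≥0} {ω : Ω} {g : ℝ → ℝ} (hg : Measurable g) {C ε : ℝ}
    (hC : ∀ s, |g s| ≤ C) (hε : ∀ s, 0 ≤ s → s < cappedHit Z O T ω → g s ≤ -ε) (n : ℕ) :
    ∑ k ∈ Finset.range n, (gridAvoid Z O δ k).indicator
        (fun _ => ∫ s in (k * (δ : ℝ))..((k + 1 : ℕ) * (δ : ℝ)), g s) ω ≤
      C * gridTime Z O δ n ω - (C + ε) * min (cappedHit Z O T ω) (n * δ) := by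
  have hint : ∀ a b : ℝ, IntervalIntegrable g volume a b := fun a b =>
    (intervalIntegrable_const (c := C)).mono_fun hg.aestronglyMeasurable
      (ae_of_all _ fun s => (hC s).trans (le_abs_self C))
  have hup : ∀ a b : ℝ, a ≤ b → ∫ s in a..b, g s ≤ C * (b - a) := fun a b hab => by
    have := intervalIntegral.integral_mono_on hab (hint a b) (intervalIntegrable_const (c := C))
      fun s _ => (le_abs_self _).trans (hC s)
    rwa [intervalIntegral.integral_const, smul_eq_mul, mul_comm] at this
  induction n with
  | zero => simp [gridTime, cappedHit_nonneg]
  | succ n ih =>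
    rw [Finset.sum_range_succ, gridTime_succ]
    have hle : n * (δ : ℝ) ≤ (n + 1 : ℕ) * (δ : ℝ) := by gcongr; omega
    have hlen : ((n + 1 : ℕ) : ℝ) * (δ : ℝ) - n * δ = δ := by push_cast; ring
    rcases le_or_gt (cappedHit Z O T ω) (n * δ) with h | h
    · rw [min_eq_left h] at ih
      rw [min_eq_left (h.trans hle)]
      by_cases hω : ω ∈ gridAvoid Z O δ n
      · rw [indicator_of_mem hω, indicator_of_mem hω]
        have := hup _ _ hle
        rw [hlen] at this
        linarith
      · rw [indicator_of_notMem hω, indicator_of_notMem hω]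
        linarith
    · rw [min_eq_right h.le] at ih
      rw [indicator_of_mem (mem_gridAvoid_of_lt h), indicator_of_mem (mem_gridAvoid_of_lt h)]
      set r := min (cappedHit Z O T ω) ((n + 1 : ℕ) * δ) with hr
      have hr1 : n * (δ : ℝ) ≤ r := le_min h.le hle
      have hr2 : r ≤ (n + 1 : ℕ) * (δ : ℝ) := min_le_right _ _
      have h1 : ∫ s in (n * (δ : ℝ))..r, g s ≤ -ε * (r - n * δ) := by
        have := intervalIntegral.integral_mono_on_of_le_Ioo hr1 (hint _ _)
          (intervalIntegrable_const (c := -ε)) fun s hs =>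
            hε s (le_trans (by positivity) hs.1.le) (hs.2.trans_le (min_le_left _ _))
        rwa [intervalIntegral.integral_const, smul_eq_mul, mul_comm (r - _)] at this
      have h2 := hup _ _ hr2
      rw [← intervalIntegral.integral_add_adjacent_intervals (hint _ r) (hint r _)]
      have h3 : ((n + 1 : ℕ) : ℝ) * (δ : ℝ) = n * δ + δ := by push_cast; ring
      rw [h3] at h2
      rw [h3]
      linarith

theorem measurable_gridTime [mΩ : MeasurableSpace Ω] {δ : ℝ≥0}
    (h : ∀ k, MeasurableSet (gridAvoid Z O δ k)) (n : ℕ) : Measurable (gridTime Z O δ n) :=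
  Finset.measurable_sum _ fun k _ => measurable_const.indicator (h k)

theorem measurable_of_rightContinuous {β : Type*} [TopologicalSpace β]
    [TopologicalSpace.PseudoMetrizableSpace β] [MeasurableSpace β] [BorelSpace β] {z : ℝ≥0 → β}
    (hz : ∀ t, ContinuousWithinAt z (Ici t) t) : Measurable z := by
  refine measurable_of_tendsto_metrizable
    (f := fun (n : ℕ) (t : ℝ≥0) => z ((⌊t * (n + 1 : ℕ)⌋₊ + 1 : ℕ) / (n + 1 : ℕ))) (g := z) (fun n => ?_)
    (tendsto_pi_nhds.2 fun t => ?_)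
  · exact (measurable_from_nat (f := fun k : ℕ => z ((k + 1 : ℕ) / (n + 1 : ℕ)))).comp
      (Nat.measurable_floor.comp (measurable_id.mul_const _))
  · have h1 : ∀ n : ℕ, t ≤ ((⌊t * (n + 1 : ℕ)⌋₊ + 1 : ℕ) : ℝ≥0) / (n + 1 : ℕ) := fun n => by
      rw [le_div_iff₀ (by positivity)]
      push_cast
      exact_mod_cast (Nat.lt_floor_add_one (t * (n + 1 : ℕ))).le
    have h2 : ∀ n : ℕ, ((⌊t * (n + 1 : ℕ)⌋₊ + 1 : ℕ) : ℝ≥0) / (n + 1 : ℕ) ≤ t + 1 / (n + 1 : ℕ) :=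
      fun n => by
        have hne : ((n + 1 : ℕ) : ℝ≥0) ≠ 0 := by positivity
        rw [div_le_iff₀ (by positivity), add_mul, one_div, inv_mul_cancel₀ hne]
        push_cast
        gcongr
        exact_mod_cast Nat.floor_le (zero_le (a := t * (n + 1 : ℕ)))
    refine (hz t).tendsto.comp (tendsto_nhdsWithin_iff.2 ⟨?_, Eventually.of_forall h1⟩)
    refine tendsto_of_tendsto_of_tendsto_of_le_of_le tendsto_const_nhds ?_ h1 h2
    have : Tendsto (fun n : ℕ => (1 : ℝ≥0) / (n + 1 : ℕ)) atTop (𝓝 0) :=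
      (tendsto_const_div_atTop_nhds_zero_nat (1 : ℝ≥0)).comp (tendsto_add_atTop_nat 1)
    simpa using (tendsto_const_nhds (x := t)).add this

end Grid

section Dynkin

variable {Ω α : Type*} [mΩ : MeasurableSpace Ω] {μ : Measure Ω} {ℱ : Filtration ℝ≥0 mΩ}
  [MeasurableSpace α] {Z : ℝ≥0 → Ω → α} {O : Set α}

theorem measurableSet_gridAvoid (hadp : Adapted ℱ Z) (hO : MeasurableSet O) (δ : ℝ≥0) (k : ℕ) :
    MeasurableSet[ℱ (k * δ)] (gridAvoid Z O δ k) := by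
  have : gridAvoid Z O δ k = ⋂ j : ℕ, ⋂ _ : j ≤ k, (Z (j * δ) ⁻¹' O)ᶜ := by
    ext ω; simp [gridAvoid]
  rw [this]
  refine MeasurableSet.iInter fun j => MeasurableSet.iInter fun hj => ?_
  refine ℱ.mono (i := j * δ) (by gcongr) _ ?_
  exact (hadp (j * δ) hO).compl

variable [TopologicalSpace α] [BorelSpace α]

theorem measurable_cappedHit (hadp : Adapted ℱ Z)
    (hrc : ∀ ω t, ContinuousWithinAt (fun s => Z s ω) (Ici t) t) (hO : IsOpen O) (T : ℝ≥0) :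
    Measurable (cappedHit Z O T) :=
  measurable_of_tendsto_metrizable
    (fun n : ℕ => measurable_gridTime (δ := T / (n + 1 : ℕ))
      (fun k => ℱ.le _ _ (measurableSet_gridAvoid hadp hO.measurableSet _ k)) (n + 1))
    (tendsto_pi_nhds.2 fun ω => tendsto_gridTime hO (hrc ω) T)

/-- A one-sided Dynkin estimate: if `F ≥ 0` decreases in mean at rate at least `ε` off the open
set `O`, then the capped hitting time of `O` has mean at most `F(z₀)/ε`. -/
theorem integral_cappedHit_le [TopologicalSpace.PseudoMetrizableSpace α]
    [IsProbabilityMeasure μ] (hadp : Adapted ℱ Z)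
    (hrc : ∀ ω t, ContinuousWithinAt (fun s => Z s ω) (Ici t) t) (hO : IsOpen O)
    {F g : α → ℝ} (hF : Measurable F) (hF0 : ∀ a, 0 ≤ F a) {B : ℝ} (hFB : ∀ a, F a ≤ B)
    (hg : Measurable g) {C : ℝ} (hgC : ∀ a, |g a| ≤ C) {ε : ℝ} (hε : 0 < ε)
    (hneg : ∀ a, a ∉ O → g a ≤ -ε) {f₀ : ℝ} (hinit : ∀ᵐ ω ∂μ, F (Z 0 ω) = f₀)
    (hM : Martingale (fun t ω => F (Z t ω) - f₀ -
      ∫ u in Ioc (0 : ℝ) (t : ℝ), g (Z u.toNNReal ω)) ℱ μ) (T : ℝ≥0) :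
    ∫ ω, cappedHit Z O T ω ∂μ ≤ f₀ / ε := by
  have hZm : ∀ t, Measurable (Z t) := fun t => (hadp t).mono (ℱ.le t) le_rfl
  have hFi : ∀ t, Integrable (fun ω => F (Z t ω)) μ := fun t =>
    Integrable.of_bound (hF.comp (hZm t)).aestronglyMeasurable B
      (ae_of_all _ fun ω => by rw [Real.norm_eq_abs, abs_of_nonneg (hF0 _)]; exact hFB _)
  have hpath : ∀ ω, Measurable fun u : ℝ => g (Z u.toNNReal ω) := fun ω =>
    hg.comp ((measurable_of_rightContinuous (hrc ω)).comp measurable_real_toNNReal)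
  have hint : ∀ ω (a b : ℝ), IntervalIntegrable (fun u : ℝ => g (Z u.toNNReal ω)) volume a b :=
    fun ω a b => (intervalIntegrable_const (c := C)).mono_fun (hpath ω).aestronglyMeasurable
      (ae_of_all _ fun s => (hgC _).trans (le_abs_self C))
  have hstep : ∀ (δ : ℝ≥0) (n : ℕ),
      Integrable (fun ω => ∫ u in (n * (δ : ℝ))..((n + 1 : ℕ) * (δ : ℝ)), g (Z u.toNNReal ω)) μ ∧
      ∫ ω in gridAvoid Z O δ n, F (Z ((n + 1 : ℕ) * δ) ω) ∂μ =
        ∫ ω in gridAvoid Z O δ n, F (Z (n * δ) ω) ∂μ + ∫ ω in gridAvoid Z O δ n,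
          (∫ u in (n * (δ : ℝ))..((n + 1 : ℕ) * (δ : ℝ)), g (Z u.toNNReal ω)) ∂μ := by
    intro δ n
    set I : Ω → ℝ := fun ω => ∫ u in (n * (δ : ℝ))..((n + 1 : ℕ) * (δ : ℝ)), g (Z u.toNNReal ω)
    set M : ℝ≥0 → Ω → ℝ := fun t ω => F (Z t ω) - f₀ -
      ∫ u in Ioc (0 : ℝ) (t : ℝ), g (Z u.toNNReal ω) with hMdef
    have hI : ∀ ω, I ω = (F (Z ((n + 1 : ℕ) * δ) ω) - F (Z (n * δ) ω)) -
        (M ((n + 1 : ℕ) * δ) ω - M (n * δ) ω) := by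
      intro ω
      have e := intervalIntegral.integral_add_adjacent_intervals
        (hint ω 0 (n * (δ : ℝ))) (hint ω (n * (δ : ℝ)) ((n + 1 : ℕ) * (δ : ℝ)))
      rw [intervalIntegral.integral_of_le (a := 0) (b := n * (δ : ℝ)) (by positivity),
        intervalIntegral.integral_of_le (a := 0) (b := (n + 1 : ℕ) * (δ : ℝ)) (by positivity)] at e
      simp only [hMdef, NNReal.coe_mul, NNReal.coe_natCast]
      linarith
    have hMi := fun t => hM.integrable t
    have hIi : Integrable I μ := by
      rw [show I = _ from funext hI]
      exact ((hFi _).sub (hFi _)).sub ((hMi _).sub (hMi _))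
    refine ⟨hIi, ?_⟩
    have hle : n * δ ≤ (n + 1 : ℕ) * δ := by gcongr; omega
    have h1 := hM.setIntegral_eq hle (measurableSet_gridAvoid hadp hO.measurableSet δ n)
    have h2 : ∫ ω in gridAvoid Z O δ n, I ω ∂μ =
        (∫ ω in gridAvoid Z O δ n, F (Z ((n + 1 : ℕ) * δ) ω) ∂μ -
          ∫ ω in gridAvoid Z O δ n, F (Z (n * δ) ω) ∂μ) -
        (∫ ω in gridAvoid Z O δ n, M ((n + 1 : ℕ) * δ) ω ∂μ -
          ∫ ω in gridAvoid Z O δ n, M (n * δ) ω ∂μ) := by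
      simp_rw [hI]
      have i1 : Integrable (fun ω => F (Z ((n + 1 : ℕ) * δ) ω) - F (Z (n * δ) ω)) μ :=
        (hFi _).sub (hFi _)
      have i2 : Integrable (fun ω => M ((n + 1 : ℕ) * δ) ω - M (n * δ) ω) μ :=
        (hMi _).sub (hMi _)
      rw [integral_sub i1.integrableOn i2.integrableOn,
        integral_sub (hFi _).integrableOn (hFi _).integrableOn,
        integral_sub (hMi _).integrableOn (hMi _).integrableOn]
    linarith
  have hmeas : ∀ (δ : ℝ≥0) (k : ℕ), MeasurableSet (gridAvoid Z O δ k) := fun δ k =>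
    ℱ.le _ _ (measurableSet_gridAvoid hadp hO.measurableSet δ k)
  have hsumint : ∀ (δ : ℝ≥0) (k : ℕ), Integrable ((gridAvoid Z O δ k).indicator fun ω =>
      ∫ u in (k * (δ : ℝ))..((k + 1 : ℕ) * (δ : ℝ)), g (Z u.toNNReal ω)) μ := fun δ k =>
    (hstep δ k).1.indicator (hmeas δ k)
  have hsum : ∀ (δ : ℝ≥0) (n : ℕ), ∫ ω in gridAvoid Z O δ n, F (Z (n * δ) ω) ∂μ ≤
      f₀ + ∫ ω, ∑ k ∈ Finset.range n, (gridAvoid Z O δ k).indicator (fun ω =>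
        ∫ u in (k * (δ : ℝ))..((k + 1 : ℕ) * (δ : ℝ)), g (Z u.toNNReal ω)) ω ∂μ := by
    intro δ n
    induction n with
    | zero =>
      have h1 : ∫ ω, F (Z 0 ω) ∂μ = f₀ := by
        rw [integral_congr_ae hinit]; simp
      have h2 := setIntegral_le_integral (s := gridAvoid Z O δ 0) (hFi 0)
        (ae_of_all _ fun ω => hF0 _)
      simp only [Nat.cast_zero, zero_mul, Finset.range_zero, Finset.sum_empty, integral_zero,
        add_zero]
      linarith
    | succ n ih =>
      have hsub : gridAvoid Z O δ (n + 1) ⊆ gridAvoid Z O δ n := fun ω hω j hj =>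
        hω j (hj.trans n.le_succ)
      have h1 : ∫ ω in gridAvoid Z O δ (n + 1), F (Z ((n + 1 : ℕ) * δ) ω) ∂μ ≤
          ∫ ω in gridAvoid Z O δ n, F (Z ((n + 1 : ℕ) * δ) ω) ∂μ :=
        setIntegral_mono_set (hFi _).integrableOn (ae_of_all _ fun ω => hF0 _)
          hsub.eventuallyLE
      simp_rw [Finset.sum_range_succ]
      rw [integral_add (integrable_finsetSum _ fun k _ => hsumint δ k) (hsumint δ n),
        integral_indicator (hmeas δ n)]
      have h2 := (hstep δ n).2
      linarith
  have hcm := measurable_cappedHit hadp hrc hO T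
  have hci : Integrable (cappedHit Z O T) μ :=
    Integrable.of_bound hcm.aestronglyMeasurable T (ae_of_all _ fun ω => by
      rw [Real.norm_eq_abs, abs_of_nonneg (cappedHit_nonneg T ω)]; exact cappedHit_le T ω)
  have hmul : ∀ n : ℕ, ((n + 1 : ℕ) : ℝ) * ((T / (n + 1 : ℕ) : ℝ≥0) : ℝ) = T := by
    intro n
    push_cast
    field_simp
  have hgm : ∀ n : ℕ, Measurable (gridTime Z O (T / (n + 1 : ℕ)) (n + 1)) := fun n =>
    measurable_gridTime (hmeas _) _
  have hgb : ∀ (n : ℕ) ω, ‖gridTime Z O (T / (n + 1 : ℕ)) (n + 1) ω‖ ≤ T := fun n ω => by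
    rw [Real.norm_eq_abs, abs_of_nonneg (gridTime_nonneg _ _ _)]
    exact (gridTime_le _ _ _).trans (hmul n).le
  have hgi : ∀ n : ℕ, Integrable (gridTime Z O (T / (n + 1 : ℕ)) (n + 1)) μ := fun n =>
    Integrable.of_bound (hgm n).aestronglyMeasurable T (ae_of_all _ (hgb n))
  have hbound : ∀ n : ℕ, -f₀ ≤ C * ∫ ω, gridTime Z O (T / (n + 1 : ℕ)) (n + 1) ω ∂μ -
      (C + ε) * ∫ ω, cappedHit Z O T ω ∂μ := by
    intro n
    have h1 := hsum (T / (n + 1 : ℕ)) (n + 1)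
    have h0 : 0 ≤ ∫ ω in gridAvoid Z O (T / (n + 1 : ℕ)) (n + 1),
        F (Z ((n + 1 : ℕ) * (T / (n + 1 : ℕ))) ω) ∂μ := integral_nonneg fun ω => hF0 _
    have h2 := integral_mono (integrable_finsetSum (Finset.range (n + 1)) fun k _ =>
      hsumint (T / (n + 1 : ℕ)) k) (((hgi n).const_mul C).sub (hci.const_mul (C + ε))) (fun ω => by
        have h3 := sum_indicator_integral_le (Z := Z) (O := O) (T := T) (δ := T / (n + 1 : ℕ))
          (ω := ω) (hpath ω) (fun s => hgC _) (ε := ε) (fun s hs hlt => hneg _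
            (notMem_of_lt_cappedHit (T := T) (by rwa [Real.coe_toNNReal s hs]))) (n + 1)
        rw [hmul, min_eq_left (cappedHit_le T ω)] at h3
        exact h3)
    rw [integral_sub' ((hgi n).const_mul C) (hci.const_mul (C + ε)), integral_const_mul,
      integral_const_mul] at h2
    linarith
  have hlim := tendsto_integral_of_dominated_convergence (μ := μ) (fun _ => (T : ℝ))
    (fun n => (hgm n).aestronglyMeasurable) (integrable_const _) (fun n => ae_of_all _ (hgb n))
    (ae_of_all _ fun ω => tendsto_gridTime hO (hrc ω) T)
  have hfin := ge_of_tendsto' ((hlim.const_mul C).sub_const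
    ((C + ε) * ∫ ω, cappedHit Z O T ω ∂μ)) hbound
  rw [le_div_iff₀ hε]
  linarith

end Dynkin

namespace Coeffs

/-- Truncation of a function by a smooth cutoff that equals `1` on the ball of radius `n + 1`. -/
def truncate (W : Rd d → Fin m → ℝ) (n : ℕ) (x : Rd d) (i : Fin m) : ℝ :=
  (⟨n + 1, n + 2, by positivity, by linarith⟩ : ContDiffBump (0 : Rd d)) x * W x i

theorem contDiff_truncate {W : Rd d → Fin m → ℝ} (hW : ∀ i, ContDiff ℝ 2 fun y => W y i) (n : ℕ)
    (i : Fin m) : ContDiff ℝ 2 fun y => truncate W n y i :=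
  (ContDiffBump.contDiff _).mul (hW i)

theorem hasCompactSupport_truncate (W : Rd d → Fin m → ℝ) (n : ℕ) (i : Fin m) :
    HasCompactSupport fun y => truncate W n y i :=
  (ContDiffBump.hasCompactSupport _).mul_right

theorem truncate_nonneg {W : Rd d → Fin m → ℝ} (hW : ∀ x i, 0 ≤ W x i) (n : ℕ) (x : Rd d)
    (i : Fin m) : 0 ≤ truncate W n x i :=
  mul_nonneg (ContDiffBump.nonneg _) (hW x i)

theorem truncate_le {W : Rd d → Fin m → ℝ} (hW : ∀ x i, 0 ≤ W x i) (n : ℕ) (x : Rd d)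
    (i : Fin m) : truncate W n x i ≤ W x i :=
  mul_le_of_le_one_left (hW x i) (ContDiffBump.le_one _)

theorem truncate_eq (W : Rd d → Fin m → ℝ) {n : ℕ} {x : Rd d} (hx : ‖x‖ ≤ n + 1)
    (i : Fin m) : truncate W n x i = W x i := by
  unfold truncate
  rw [ContDiffBump.one_of_mem_closedBall _ (by simpa using hx), one_mul]

/-- Truncating a nonnegative function does not increase its generator on the inner ball. -/
theorem Standing.G_truncate_le {c : Coeffs d m} (hc : c.Standing) {W : Rd d → Fin m → ℝ}
    (hW : ∀ i, ContDiff ℝ 2 fun y => W y i) (hW0 : ∀ x i, 0 ≤ W x i) {n : ℕ} {x : Rd d}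
    (hx : ‖x‖ ≤ n) {i : Fin m} (hi : Integrable (jumpIntegrand W x i) (c.jump x i)) :
    c.G (truncate W n) x i ≤ c.G W x i := by
  have hx1 : ‖x‖ ≤ n + 1 := by linarith
  have hev : (fun y => truncate W n y i) =ᶠ[𝓝 x] fun y => W y i := by
    have : Metric.ball (0 : Rd d) (n + 1) ∈ 𝓝 x :=
      Metric.isOpen_ball.mem_nhds (by rw [mem_ball_zero_iff]; linarith)
    filter_upwards [this] with y hy
    exact truncate_eq W (by rw [mem_ball_zero_iff] at hy; exact hy.le) i
  obtain ⟨B, hB⟩ := (hasCompactSupport_truncate W n i).exists_bound_of_continuous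
    (contDiff_truncate hW n i).continuous
  have hti := hc.integrable_jumpIntegrand_of_bounded (contDiff_truncate hW n i) hB x
  have hq : ∑ j, c.q x i j * truncate W n x j = ∑ j, c.q x i j * W x j :=
    Finset.sum_congr rfl fun j _ => by rw [truncate_eq W hx1]
  unfold G
  rw [hev.fderiv_eq, (hev.iteratedFDeriv ℝ 2).eq_of_nhds, hq]
  refine add_le_add_left (add_le_add_right (integral_mono hti hi fun z => ?_) _) _
  simp only [jumpIntegrand, hev.fderiv_eq, truncate_eq W hx1]
  gcongr
  exact truncate_le hW0 n (x + z) i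

end Coeffs

theorem hitTime_anti {Ω α : Type*} (Z : ℝ≥0 → Ω → α) {U U' : Set α} (h : U ⊆ U') (ω : Ω) :
    hitTime Z U' ω ≤ hitTime Z U ω :=
  le_iInf₂ fun t ht => iInf₂_le t (h ht)

/-- A path with left and right limits is bounded on compact time intervals. -/
theorem exists_norm_le_of_cadlag {E : Type*} [NormedAddCommGroup E] {z : ℝ≥0 → E}
    (hr : ∀ t, ContinuousWithinAt z (Ici t) t)
    (hl : ∀ t, 0 < t → ∃ L, Tendsto z (𝓝[<] t) (𝓝 L)) (T : ℝ≥0) :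
    ∃ C : ℝ, ∀ t ≤ T, ‖z t‖ ≤ C := by
  have key : Bornology.IsBounded (z '' Icc 0 T) := by
    refine isCompact_Icc.induction_on (p := fun s => Bornology.IsBounded (z '' s)) (by simp)
      (fun s t hst h => h.subset (image_mono hst))
      (fun s t h1 h2 => by rw [image_union]; exact h1.union h2) fun t _ => ?_
    have hb : ∀ (F : Filter ℝ≥0) (L : E), Tendsto z F (𝓝 L) →
        ∃ s ∈ F, Bornology.IsBounded (z '' s) := fun F L h =>
      ⟨z ⁻¹' Metric.ball L 1, h (Metric.ball_mem_nhds L one_pos),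
        Metric.isBounded_ball.subset (image_preimage_subset _ _)⟩
    obtain ⟨s1, hs1, hb1⟩ := hb _ _ (hr t)
    obtain ⟨s2, hs2, hb2⟩ : ∃ s ∈ 𝓝[<] t, Bornology.IsBounded (z '' s) := by
      rcases eq_or_lt_of_le (zero_le (a := t)) with h0 | h0
      · refine ⟨∅, ?_, by simp⟩
        have : Iio t = ∅ := by rw [← h0]; ext; simp
        rw [this, nhdsWithin_empty]
        exact mem_bot
      · obtain ⟨L, hL⟩ := hl t h0
        exact hb _ L hL
    refine ⟨s1 ∪ s2, mem_nhdsWithin_of_mem_nhds ?_, by rw [image_union]; exact hb1.union hb2⟩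
    rw [← nhdsLT_sup_nhdsGE]
    exact ⟨mem_of_superset hs2 subset_union_right, mem_of_superset hs1 subset_union_left⟩
  obtain ⟨C, hC⟩ := key.exists_norm_le
  exact ⟨C, fun t ht => hC _ (mem_image_of_mem z ⟨zero_le, ht⟩)⟩

/-- The hitting time is the limit of the hitting times localized to balls. -/
theorem hitTime_le_iSup_cappedHit {Ω : Type*} {X : ℝ≥0 → Ω → Rd d} {Λ : ℝ≥0 → Ω → Fin m}
    (U : Set (Rd d × Fin m)) {ω : Ω} (hb : ∀ T : ℝ≥0, ∃ C : ℝ, ∀ t ≤ T, ‖X t ω‖ ≤ C) :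
    hitTime (fun t ω => (X t ω, Λ t ω)) U ω ≤ ⨆ n : ℕ, ENNReal.ofReal
      (cappedHit (fun t ω => (X t ω, Λ t ω)) (U ∪ {p | (n : ℝ) < ‖p.1‖}) n ω) := by
  refine ENNReal.le_of_forall_nnreal_lt fun t ht => ?_
  obtain ⟨C, hC⟩ := hb t
  obtain ⟨n, hn⟩ := exists_nat_ge (max C t)
  refine le_iSup_of_le n ?_
  rw [ofReal_cappedHit]
  refine le_min (le_iInf₂ fun s hs => ?_) ?_
  · by_contra hlt
    have hst : s < t := by exact_mod_cast not_le.1 hlt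
    rcases hs with hs | hs
    · exact hlt (ht.trans_le (iInf₂_le s hs)).le
    · have h1 : (n : ℝ) < ‖X s ω‖ := hs
      linarith [hC s hst.le, (le_max_left C (t : ℝ)).trans hn]
  · exact_mod_cast (le_max_right C (t : ℝ)).trans hn

end

theorem finite_mean_hitting_with_fixed_discrete_component {d m : ℕ} (hd : 1 ≤ d) (hm : 1 ≤ m)
    {Ω : Type*} [mΩ : MeasurableSpace Ω]
    (c : Coeffs d m) (hc : c.Standing)
    (ℱ : Filtration ℝ≥0 mΩ) (X : ℝ≥0 → Ω → Rd d) (Λ : ℝ≥0 → Ω → Fin m)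
    (P : Rd d → Fin m → Measure Ω) (hP : IsSwitchingJumpDiffusion c ℱ X Λ P)
    (hirr : ∀ E : Set (Rd d), BddDomain E → c.StrictIrred E)
    (D : Set (Rd d)) (hD : BddDomain D) (hC1 : c.C1 D)
    (x : Rd d) (i l : Fin m) :
    (∫⁻ ω, hitTime (fun t ω => (X t ω, Λ t ω)) (D ×ˢ {l}) ω ∂(P x i)) < ⊤ := by
  obtain ⟨W, hW2, hW0, hWG⟩ := hc.exists_lyapunov_singleton hd hD (hirr D hD) hC1 l
  have := hP.prob x i
  set Z : ℝ≥0 → Ω → Rd d × Fin m := fun t ω => (X t ω, Λ t ω)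
  let O : ℕ → Set (Rd d × Fin m) := fun n => D ×ˢ {l} ∪ {p | (n : ℝ) < ‖p.1‖}
  have hO : ∀ n, IsOpen (O n) := fun n =>
    (hD.1.prod (isOpen_discrete _)).union (isOpen_lt continuous_const continuous_fst.norm)
  have hrc := hP.cadlag_right
  have hbound : ∀ n : ℕ, ∫ ω, cappedHit Z (O n) n ω ∂(P x i) ≤ W x i / (1 / 2) := by
    intro n
    have hT2 := Coeffs.contDiff_truncate hW2 n
    have hTs := Coeffs.hasCompactSupport_truncate W n
    have hT0 := Coeffs.truncate_nonneg hW0 n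
    obtain ⟨C, hC⟩ := hc.exists_abs_G_le hT2 hTs
    have hcb := Coeffs.isCb2_of_hasCompactSupport hT2 hTs
    choose B hB using hcb.2
    have hM := hP.martingale_problem _ hcb ⟨C, hC⟩ x i
    have hinit : ∀ᵐ ω ∂(P x i), Coeffs.truncate W n (X 0 ω) (Λ 0 ω) = Coeffs.truncate W n x i := by
      have h0 : ∀ᵐ ω ∂(P x i), X 0 ω = x ∧ Λ 0 ω = i := by
        have hms : MeasurableSet {ω | X 0 ω = x ∧ Λ 0 ω = i} := by
          have h1 : Measurable (Z 0) := (hP.adapted 0).mono (ℱ.le 0) le_rfl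
          have h2 : {ω | X 0 ω = x ∧ Λ 0 ω = i} = Z 0 ⁻¹' {(x, i)} := by
            ext ω; simp [Z]
          rw [h2]
          exact h1 (measurableSet_singleton _)
        exact (mem_ae_iff_prob_eq_one hms).2 (hP.init x i)
      filter_upwards [h0] with ω hω
      rw [hω.1, hω.2]
    have key := integral_cappedHit_le (μ := P x i) (Z := Z) (O := O n) hP.adapted hrc (hO n)
      (F := fun p => Coeffs.truncate W n p.1 p.2) (g := fun p => c.G (Coeffs.truncate W n) p.1 p.2)
      (measurable_from_prod_countable_left fun j => (hT2 j).continuous.measurable)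
      (fun p => hT0 p.1 p.2) (B := ∑ j, |B j|) (fun p => ?_) (hc.measurable_G hT2)
      (fun p => hC p.1 p.2) (ε := 1 / 2) (by norm_num) (fun p hp => ?_) hinit hM n
    · exact key.trans (by gcongr; exact Coeffs.truncate_le hW0 n x i)
    · refine (le_abs_self _).trans (((hB p.2 p.1).1.trans (le_abs_self _)).trans ?_)
      exact Finset.single_le_sum (f := fun j => |B j|) (fun j _ => abs_nonneg _)
        (Finset.mem_univ p.2)
    · have hp1 : ¬ (p.1 ∈ D ∧ p.2 = l) := fun h => hp (Or.inl ⟨h.1, h.2⟩)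
      have hp2 : ‖p.1‖ ≤ n := not_lt.1 fun h => hp (Or.inr h)
      obtain ⟨h1, h2⟩ := hWG p.1 p.2 hp1
      exact (hc.G_truncate_le hW2 hW0 hp2 h1).trans h2
  have hcm : ∀ n : ℕ, Measurable (cappedHit Z (O n) n) := fun n =>
    measurable_cappedHit hP.adapted hrc (hO n) n
  have hmono : Monotone fun (n : ℕ) ω => ENNReal.ofReal (cappedHit Z (O n) n ω) := by
    intro n k hnk ω
    simp only [ofReal_cappedHit]
    refine min_le_min (hitTime_anti Z (union_subset_union_right _ fun p hp => ?_) ω) ?_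
    · exact lt_of_le_of_lt (by exact_mod_cast hnk) (show (k : ℝ) < ‖p.1‖ from hp)
    · exact_mod_cast hnk
  have hpath : ∀ ω (T : ℝ≥0), ∃ C : ℝ, ∀ t ≤ T, ‖X t ω‖ ≤ C := fun ω =>
    exists_norm_le_of_cadlag (fun t => (hrc ω t).fst) fun t ht => by
      obtain ⟨L, hL⟩ := hP.cadlag_left ω t ht
      exact ⟨L.1, (continuous_fst.tendsto L).comp hL⟩
  calc ∫⁻ ω, hitTime Z (D ×ˢ {l}) ω ∂(P x i)
      ≤ ∫⁻ ω, ⨆ n : ℕ, ENNReal.ofReal (cappedHit Z (O n) n ω) ∂(P x i) :=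
        lintegral_mono fun ω => hitTime_le_iSup_cappedHit _ (hpath ω)
    _ = ⨆ n : ℕ, ∫⁻ ω, ENNReal.ofReal (cappedHit Z (O n) n ω) ∂(P x i) :=
        lintegral_iSup (fun n => (hcm n).ennreal_ofReal) hmono
    _ ≤ ENNReal.ofReal (W x i / (1 / 2)) := by
        refine iSup_le fun n => ?_
        rw [← ofReal_integral_eq_lintegral_ofReal
          (Integrable.of_bound (hcm n).aestronglyMeasurable n (ae_of_all _ fun ω => by
            rw [Real.norm_eq_abs, abs_of_nonneg (cappedHit_nonneg _ ω)]
            exact_mod_cast cappedHit_le (n : ℝ≥0) ω))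
          (ae_of_all _ fun ω => cappedHit_nonneg _ ω)]
        exact ENNReal.ofReal_le_ofReal (hbound n)
    _ < ⊤ := ENNReal.ofReal_lt_top
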